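/- Let W be a d-dimensional Brownian sheet on [0,1]^2 and let b : [0,1]^2 × ℝ^d → ℝ^d be Borel measurable such that each component b_i = b̂_i − b̌_i with b̂_i, b̌_i bounded and componentwise nondecreasing in x. Then there exist a set Ω₁ with ℙ(Ω₁) = 1 and a positive random variable C₂ such that for every ω ∈ Ω₁, every positive integer n with C₂(ω)√(dn) 2^{−n} ≤ 1/6, every β ∈ [2^{−4^{3n/4}}, 2^{−4^{2n/3}}], every continuous u : [0,1]^2 → ℝ^d satisfying u(s,t) − u(s,0) − u(0,t) + u(0,0) = ∫_0^t ∫_0^s { b(s₁,t₁,W_{s₁,t₁}(ω)+u(s₁,t₁)) − b(s₁,t₁,W_{s₁,t₁}(ω)) } ds₁ dt₁ for all (s,t) ∈ [0,1]^2 and max_{1≤i≤d} max{|u_i(s,0)|, |u_i(0,t)|} ≤ β for all (s,t) ∈ [0,1]^2, and every pair (k,k') ∈ {1,...,2^n}^2, one has max_{1≤i≤d} max{ ū_{n,i}(k,k'), ṳ_{n,i}(k,k') } ≤ 3^{k+k'−1} (1 + 3 C₂(ω) √(dn) 2^{−n})^{k+k'} β, where ū_{n,i}(k,k') = sup_{(s,t)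 ∈ I_{n,k−1} × I_{n,k'−1}} max{0, u_i(s,t)} and ṳ_{n,i}(k,k') = sup_{(s,t) ∈ I_{n,k−1} × I_{n,k'−1}} max{0, −u_i(s,t)} with I_{nj} = (j2^{−n}, (j+1)2^{−n}]. -/

import Mathlib

open MeasureTheory ProbabilityTheory Set Filter

noncomputable section

/-- A `d`-dimensional Brownian sheet on `[0,1]²`. -/
def IsBrownianSheet {Ω : Type*} [MeasurableSpace Ω] (P : Measure Ω) (d : ℕ)
    (W : ℝ × ℝ → Ω → EuclideanSpace ℝ (Fin d)) : Prop :=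
  (∀ p, Measurable (W p)) ∧
  (∀ ω, ContinuousOn (fun p => W p ω) (Set.Icc (0 : ℝ × ℝ) 1)) ∧
  (∀ ω, ∀ p ∈ Set.Icc (0 : ℝ × ℝ) 1, p.1 = 0 ∨ p.2 = 0 → W p ω = 0) ∧
  (∀ (n : ℕ) (p : Fin n → ℝ × ℝ) (idx : Fin n → Fin d) (c : Fin n → ℝ),
    (∀ j, p j ∈ Set.Icc (0 : ℝ × ℝ) 1) →
    P.map (fun ω => ∑ j, c j * W (p j) ω (idx j)) =
      gaussianReal 0 (∑ j, ∑ k, c j * c k *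
        (if idx j = idx k then min (p j).1 (p k).1 * min (p j).2 (p k).2 else 0)).toNNReal)

/-- The σ-algebra generated by the sheet up to `p`. -/
def sheetSigma {Ω : Type*} [MeasurableSpace Ω] {d : ℕ}
    (W : ℝ × ℝ → Ω → EuclideanSpace ℝ (Fin d)) (p : ℝ × ℝ) : MeasurableSpace Ω :=
  ⨆ q ∈ Set.Icc (0 : ℝ × ℝ) p, MeasurableSpace.comap (W q) inferInstance

/-- A strong solution of the sheet SDE. -/
def IsStrongSolution {Ω : Type*} [MeasurableSpace Ω] (P : Measure Ω) {d : ℕ}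
    (W : ℝ × ℝ → Ω → EuclideanSpace ℝ (Fin d))
    (b : ℝ × ℝ → EuclideanSpace ℝ (Fin d) → EuclideanSpace ℝ (Fin d))
    (ξ : EuclideanSpace ℝ (Fin d))
    (X : ℝ × ℝ → Ω → EuclideanSpace ℝ (Fin d)) : Prop :=
  (∀ ω, ContinuousOn (fun p => X p ω) (Set.Icc (0 : ℝ × ℝ) 1)) ∧
  (∀ p ∈ Set.Icc (0 : ℝ × ℝ) 1, ∃ Y : Ω → EuclideanSpace ℝ (Fin d),
      Measurable[sheetSigma W p] Y ∧ ∀ᵐ ω ∂P, X p ω = Y ω) ∧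
  (∀ᵐ ω ∂P, ∀ p ∈ Set.Icc (0 : ℝ × ℝ) 1,
      X p ω = ξ + (∫ t₁ in (0:ℝ)..p.2, ∫ s₁ in (0:ℝ)..p.1, b (s₁, t₁) (X (s₁, t₁) ω)) + W p ω)

section Auxiliary

open scoped Topology ENNReal NNReal

/-- A continuous image of Baire space is inner regular with respect to compact sets. -/
lemma exists_isCompact_subset_range_le_measure {α : Type*} [TopologicalSpace α]
    [MeasurableSpace α] (μ : Measure α) [μ.OuterRegular]
    {f : (ℕ → ℕ) → α} (hf : Continuous f) {c : ℝ≥0∞} (hc : c < μ (range f)) :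
    ∃ K ⊆ range f, IsCompact K ∧ c ≤ μ K := by
  let A : (n : ℕ) → (Fin n → ℕ) → Set (ℕ → ℕ) := fun n k => {σ | ∀ i : Fin n, σ i ≤ k i}
  have step : ∀ B : Set (ℕ → ℕ), c < μ (f '' B) → ∀ n : ℕ,
      ∃ m : ℕ, c < μ (f '' (B ∩ {σ | σ n ≤ m})) := by
    intro B hB n
    have hU : f '' B = ⋃ m : ℕ, f '' (B ∩ {σ | σ n ≤ m}) := by
      rw [← image_iUnion, ← inter_iUnion]
      congr 1
      ext σ
      simp only [mem_inter_iff, mem_iUnion, mem_ofPred_eq, iff_self_and]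
      exact fun _ => ⟨_, le_rfl⟩
    have hmono : Monotone fun m : ℕ => f '' (B ∩ {σ | σ n ≤ m}) := fun a b hab =>
      image_mono (inter_subset_inter_right _ fun σ (h : σ n ≤ a) => h.trans hab)
    rw [hU, hmono.directed_le.measure_iUnion] at hB
    exact lt_iSup_iff.1 hB
  choose! m hm using step
  let B : ℕ → Set (ℕ → ℕ) := fun n => n.rec univ fun n B => B ∩ {σ | σ n ≤ m B n}
  have hBs : ∀ n, B (n + 1) = B n ∩ {σ | σ n ≤ m (B n) n} := fun n => rfl
  have hB : ∀ n, c < μ (f '' B n) := by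
    intro n
    induction n with
    | zero => simpa [B] using hc
    | succ n ih => rw [hBs]; exact hm _ ih n
  let k : ℕ → ℕ := fun n => m (B n) n
  have hBmem : ∀ n σ, σ ∈ B n ↔ ∀ i < n, σ i ≤ k i := by
    intro n
    induction n with
    | zero => intro σ; simp [B]
    | succ n ih =>
      intro σ
      rw [hBs, mem_inter_iff, ih]
      constructor
      · rintro ⟨h1, h2⟩ i hi
        rcases Nat.lt_succ_iff_lt_or_eq.1 hi with h | rfl
        · exact h1 i h
        · exact h2
      · exact fun h => ⟨fun i hi => h i (hi.trans n.lt_succ_self), h n n.lt_succ_self⟩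
  let C : Set (ℕ → ℕ) := univ.pi fun i => Iic (k i)
  have hC : IsCompact C := isCompact_univ_pi fun i => (finite_Iic (k i)).isCompact
  refine ⟨f '' C, image_subset_range _ _, hC.image hf, ?_⟩
  rw [Set.measure_eq_iInf_isOpen]
  refine le_iInf₂ fun U hU => le_iInf fun hUo => ?_
  suffices ∃ n, B n ⊆ f ⁻¹' U by
    obtain ⟨n, hn⟩ := this
    exact (hB n).le.trans (measure_mono (image_subset_iff.2 hn))
  by_contra! hcon
  simp only [not_subset] at hcon
  choose σ hσ hσU using hcon
  let τ : ℕ → ℕ → ℕ := fun n i => min (σ n i) (k i)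
  obtain ⟨τ₀, hτ₀, φ, hφ, hlim⟩ := hC.tendsto_subseq (x := τ)
    fun n i _ => mem_Iic.2 (min_le_right (σ n i) (k i))
  have hlim' : Tendsto (fun n => σ (φ n)) atTop (𝓝 τ₀) := by
    rw [tendsto_pi_nhds] at hlim ⊢
    intro i
    refine (hlim i).congr' ?_
    filter_upwards [eventually_gt_atTop i] with n hn
    exact min_eq_left ((hBmem _ _).1 (hσ (φ n)) i (hn.trans_le (hφ.id_le n)))
  have hcl : IsClosed (f ⁻¹' U)ᶜ := (hUo.preimage hf).isClosed_compl
  exact hcl.mem_of_tendsto hlim' (Eventually.of_forall fun n => hσU (φ n))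
    (hU (mem_image_of_mem f hτ₀))

/-- Analytic sets are universally measurable. -/
lemma MeasureTheory.AnalyticSet.nullMeasurableSet {α : Type*} [TopologicalSpace α] [PolishSpace α]
    [MeasurableSpace α] [BorelSpace α] {s : Set α} (hs : AnalyticSet s) (μ : Measure α)
    [SFinite μ] : NullMeasurableSet s μ := by
  suffices h : ∀ ν : Measure α, IsFiniteMeasure ν → NullMeasurableSet s ν from
    (h μ.toFinite inferInstance).mono_ac (absolutelyContinuous_toFinite μ)
  intro ν _
  rw [AnalyticSet] at hs
  rcases hs with rfl | ⟨f, hf, rfl⟩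
  · exact nullMeasurableSet_empty
  have hK : ∀ c : ℝ≥0∞, c < ν (range f) → ∃ K ⊆ range f, MeasurableSet K ∧ c ≤ ν K := fun c hc => by
    obtain ⟨K, h1, h2, h3⟩ := exists_isCompact_subset_range_le_measure ν hf hc
    exact ⟨K, h1, h2.measurableSet, h3⟩
  rcases eq_or_ne (ν (range f)) 0 with h0 | h0
  · exact NullMeasurableSet.of_null h0
  obtain ⟨c, -, hc, hlim⟩ := exists_seq_strictMono_tendsto' (pos_iff_ne_zero.2 h0)
  choose K hKs hKm hKc using fun n => hK (c n) (hc n).2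
  have hU : ν (range f) ≤ ν (⋃ n, K n) :=
    le_of_tendsto' hlim fun n => (hKc n).trans (measure_mono (subset_iUnion K n))
  have hae : (⋃ n, K n) =ᵐ[ν] range f :=
    ae_eq_of_subset_of_measure_ge (iUnion_subset hKs) hU
      (MeasurableSet.iUnion hKm).nullMeasurableSet (measure_ne_top _ _)
  exact (MeasurableSet.iUnion hKm).nullMeasurableSet.congr hae

/-- The supremum of a bounded family of Borel functions indexed by a Polish space has a Borel
majorant that agrees with it almost everywhere. -/
lemma exists_measurable_ge_forall {Z U : Type*} [TopologicalSpace Z] [PolishSpace Z]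
    [MeasurableSpace Z] [BorelSpace Z] [TopologicalSpace U] [PolishSpace U] [MeasurableSpace U]
    [BorelSpace U] [Nonempty U] (μ : Measure Z) [SFinite μ] {f : Z × U → ℝ} (hf : Measurable f)
    {K : ℝ} (hK : ∀ z, f z ∈ Icc 0 K) :
    ∃ g : Z → ℝ, Measurable g ∧ (∀ z, g z ∈ Icc 0 K) ∧ (∀ z u, f (z, u) ≤ g z) ∧
      ∀ᵐ z ∂μ, ∀ c, (∀ u, f (z, u) ≤ c) → g z ≤ c := by
  let G : Z → ℝ := fun z => ⨆ u, f (z, u)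
  have hbdd : ∀ z, BddAbove (range fun u => f (z, u)) := fun z =>
    ⟨K, by rintro _ ⟨u, rfl⟩; exact (hK _).2⟩
  have hfG : ∀ z u, f (z, u) ≤ G z := fun z u => le_ciSup (hbdd z) u
  have hG : ∀ z, G z ∈ Icc 0 K := fun z =>
    ⟨(hK _).1.trans (hfG z (Classical.arbitrary U)), ciSup_le fun u => (hK _).2⟩
  have hGm : NullMeasurable G μ := by
    have h : ∀ c, NullMeasurableSet (G ⁻¹' Ioi c) μ := fun c => by
      have : G ⁻¹' Ioi c = Prod.fst '' (f ⁻¹' Ioi c) := by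
        ext z
        simp only [mem_preimage, mem_Ioi, mem_image, Prod.exists, exists_and_right, exists_eq_right]
        exact lt_ciSup_iff (hbdd z)
      rw [this]
      exact ((hf measurableSet_Ioi).analyticSet_image measurable_fst).nullMeasurableSet μ
    have : @Measurable (NullMeasurableSpace Z μ) ℝ _ _ G := measurable_of_Ioi h
    exact this
  have hGa : AEMeasurable G μ := hGm.aemeasurable
  let N := toMeasurable μ {z | G z ≠ hGa.mk G z}
  have hN : μ N = 0 := by rw [measure_toMeasurable]; exact hGa.ae_eq_mk
  have hNz : ∀ z ∉ N, hGa.mk G z = G z := fun z hz => by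
    by_contra h
    exact hz (subset_toMeasurable _ _ (Ne.symm h))
  classical
  refine ⟨N.piecewise (fun _ => K) (hGa.mk G),
    Measurable.piecewise (measurableSet_toMeasurable _ _) measurable_const hGa.measurable_mk,
    fun z => ?_, fun z u => ?_, ?_⟩
  · by_cases hz : z ∈ N
    · rw [piecewise_eq_of_mem _ _ _ hz]
      exact ⟨(hG z).1.trans (hG z).2, le_rfl⟩
    · rw [piecewise_eq_of_notMem _ _ _ hz, hNz z hz]
      exact hG z
  · by_cases hz : z ∈ N
    · rw [piecewise_eq_of_mem _ _ _ hz]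
      exact (hK _).2
    · rw [piecewise_eq_of_notMem _ _ _ hz, hNz z hz]
      exact hfG z u
  · filter_upwards [compl_mem_ae_iff.2 hN] with z hz c hc
    rw [piecewise_eq_of_notMem _ _ _ hz, hNz z hz]
    exact ciSup_le hc

/-- The vector all of whose coordinates equal `x`. -/
def diagVec (d : ℕ) (x : ℝ) : EuclideanSpace ℝ (Fin d) := WithLp.toLp 2 fun _ => x

@[simp] lemma diagVec_apply (d : ℕ) (x : ℝ) (i : Fin d) : diagVec d x i = x := rfl

lemma measurable_diagVec (d : ℕ) : Measurable (diagVec d) :=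
  (PiLp.continuous_toLp 2 _).measurable.comp (measurable_pi_lambda _ fun _ => measurable_id)

/-- The oscillation over a cube of a difference of monotone functions has a Borel majorant which
is almost everywhere controlled by diagonal increments of the monotone parts. -/
lemma exists_oscillation_majorant {d : ℕ}
    {b bhat bcheck : ℝ × ℝ → EuclideanSpace ℝ (Fin d) → EuclideanSpace ℝ (Fin d)}
    (hmeas : Measurable fun q : (ℝ × ℝ) × EuclideanSpace ℝ (Fin d) => b q.1 q.2)
    (hdecomp : ∀ p x, b p x = bhat p x - bcheck p x)
    (hmono : ∀ p (x y : EuclideanSpace ℝ (Fin d)), (∀ j, x j ≤ y j) →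
      ∀ i, bhat p x i ≤ bhat p y i ∧ bcheck p x i ≤ bcheck p y i)
    (i : Fin d) {K : ℝ} (hK : ∀ p x, |bhat p x i| ≤ K ∧ |bcheck p x i| ≤ K) {x : ℝ} (hx : 0 ≤ x) :
    ∃ g : (ℝ × ℝ) × EuclideanSpace ℝ (Fin d) → ℝ, Measurable g ∧ (∀ z, g z ∈ Icc 0 (4 * K)) ∧
      (∀ p y u, (∀ j, |u j| ≤ x) → |b p (y + u) i - b p y i| ≤ g (p, y)) ∧
      ∀ᵐ z, g z ≤ (bhat z.1 (z.2 + diagVec d x) i + bcheck z.1 (z.2 + diagVec d x) i) -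
        (bhat z.1 (z.2 - diagVec d x) i + bcheck z.1 (z.2 - diagVec d x) i) := by
  classical
  have hK0 : 0 ≤ K := (abs_nonneg _).trans (hK 0 0).1
  have hb : ∀ p y u, (∀ j, |u j| ≤ x) → |b p (y + u) i - b p y i| ≤
      (bhat p (y + diagVec d x) i + bcheck p (y + diagVec d x) i) -
        (bhat p (y - diagVec d x) i + bcheck p (y - diagVec d x) i) := by
    intro p y u hu
    have h1 := hmono p (y + u) (y + diagVec d x) (fun j => by
      simpa using (abs_le.1 (hu j)).2) i
    have h2 := hmono p (y - diagVec d x) (y + u) (fun j => by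
      have := (abs_le.1 (hu j)).1
      simp only [PiLp.sub_apply, PiLp.add_apply, diagVec_apply]; linarith) i
    have h3 := hmono p y (y + diagVec d x) (fun j => by simpa using hx) i
    have h4 := hmono p (y - diagVec d x) y (fun j => by simpa using hx) i
    rw [hdecomp, hdecomp, PiLp.sub_apply, PiLp.sub_apply, abs_le]
    constructor <;> linarith
  let S : Set (((ℝ × ℝ) × EuclideanSpace ℝ (Fin d)) × EuclideanSpace ℝ (Fin d)) :=
    {z | ∀ j, |z.2 j| ≤ x}
  have hS : MeasurableSet S := by
    have : S = ⋂ j, {z | |z.2 j| ≤ x} := by ext; simp [S]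
    rw [this]
    exact MeasurableSet.iInter fun j => measurableSet_le (by fun_prop) measurable_const
  let f : ((ℝ × ℝ) × EuclideanSpace ℝ (Fin d)) × EuclideanSpace ℝ (Fin d) → ℝ :=
    S.indicator fun z => |b z.1.1 (z.1.2 + z.2) i - b z.1.1 z.1.2 i|
  have hbi : Measurable fun q : (ℝ × ℝ) × EuclideanSpace ℝ (Fin d) => b q.1 q.2 i := by
    fun_prop
  have hf : Measurable f := by
    refine Measurable.indicator ?_ hS
    have h1 := hbi.comp (f := fun z : ((ℝ × ℝ) × EuclideanSpace ℝ (Fin d)) ×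
      EuclideanSpace ℝ (Fin d) => (z.1.1, z.1.2 + z.2)) (by fun_prop)
    have h2 := hbi.comp (f := fun z : ((ℝ × ℝ) × EuclideanSpace ℝ (Fin d)) ×
      EuclideanSpace ℝ (Fin d) => z.1) (by fun_prop)
    exact (h1.sub h2).abs
  have hfK : ∀ z, f z ∈ Icc 0 (4 * K) := by
    intro z
    refine ⟨indicator_nonneg (fun _ _ => abs_nonneg _) _, ?_⟩
    by_cases hz : z ∈ S
    swap
    · rw [show f z = _ from indicator_of_notMem hz _]
      positivity
    rw [show f z = _ from indicator_of_mem hz _]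
    have h1 := abs_le.1 (hK z.1.1 (z.1.2 + z.2)).1
    have h2 := abs_le.1 (hK z.1.1 (z.1.2 + z.2)).2
    have h3 := abs_le.1 (hK z.1.1 z.1.2).1
    have h4 := abs_le.1 (hK z.1.1 z.1.2).2
    rw [hdecomp, hdecomp, PiLp.sub_apply, PiLp.sub_apply, abs_le]
    constructor <;> linarith
  obtain ⟨g, hg, hgK, hfg, hae⟩ := exists_measurable_ge_forall volume hf hfK
  refine ⟨g, hg, hgK, fun p y u hu => ?_, ?_⟩
  · have h := hfg (p, y) u
    have huS : ((p, y), u) ∈ S := by simpa [S] using hu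
    rwa [show f ((p, y), u) = _ from indicator_of_mem huS _] at h
  · filter_upwards [hae] with z hz
    refine hz _ fun u => ?_
    by_cases hu : (z, u) ∈ S
    · rw [show f (z, u) = _ from indicator_of_mem hu _]
      exact hb _ _ _ (by simpa [S] using hu)
    · rw [show f (z, u) = _ from indicator_of_notMem hu _]
      simpa using (abs_nonneg _).trans (hb z.1 z.2 0 (fun j => by simpa using hx))

/-- The total mass of the increments `f (τ + x) - f (τ - x)` of a bounded monotone function. -/
lemma lintegral_monotone_increment_le {f : ℝ → ℝ} (hf : Monotone f) {K : ℝ} (hK : ∀ τ, |f τ| ≤ K)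
    {x : ℝ} (hx : 0 ≤ x) :
    ∫⁻ τ, ENNReal.ofReal (f (τ + x) - f (τ - x)) ≤ ENNReal.ofReal (4 * K * x) := by
  have hm : Measurable fun τ => ENNReal.ofReal (f (τ + x) - f (τ - x)) :=
    ((hf.measurable.comp (measurable_add_const x)).sub
      (hf.measurable.comp (measurable_sub_const x))).ennreal_ofReal
  have hlim := (aecover_Icc (μ := volume) tendsto_neg_atTop_atBot
    (tendsto_id (α := ℝ) (x := atTop))).lintegral_tendsto_of_countably_generated hm.aemeasurable
  refine le_of_tendsto hlim ?_
  filter_upwards [eventually_ge_atTop 0] with R hR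
  have hint : ∀ a b, IntervalIntegrable f volume a b := fun a b => hf.intervalIntegrable
  have hR' : -R ≤ R := by linarith
  have h1 : IntervalIntegrable (fun τ => f (τ + x)) volume (-R) R :=
    Monotone.intervalIntegrable fun a b hab => hf (by linarith)
  have h2 : IntervalIntegrable (fun τ => f (τ - x)) volume (-R) R :=
    Monotone.intervalIntegrable fun a b hab => hf (by linarith)
  simp only [id]
  rw [setLIntegral_congr Ioc_ae_eq_Icc.symm, ← ofReal_integral_eq_lintegral_ofReal
    ((intervalIntegrable_iff_integrableOn_Ioc_of_le hR').1 (h1.sub h2))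
    (Eventually.of_forall fun τ => sub_nonneg.2 (hf (by linarith))),
    ← intervalIntegral.integral_of_le hR']
  refine ENNReal.ofReal_le_ofReal ?_
  rw [intervalIntegral.integral_sub h1 h2, intervalIntegral.integral_comp_add_right (fun τ => f τ),
    intervalIntegral.integral_comp_sub_right (fun τ => f τ),
    intervalIntegral.integral_interval_sub_interval_comm (hint _ _) (hint _ _) (hint _ _)]
  have h3 : ∀ a, |∫ τ in (a + x)..(a - x), f τ| ≤ K * (2 * x) := fun a => by
    have := intervalIntegral.norm_integral_le_of_norm_le_const (a := a + x) (b := a - x) (f := f)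
      (C := K) fun τ _ => hK τ
    rwa [Real.norm_eq_abs, show a - x - (a + x) = -(2 * x) by ring, abs_neg,
      abs_of_nonneg (by linarith : 0 ≤ 2 * x)] at this
  have h4 := abs_le.1 (h3 (-R))
  have h5 := abs_le.1 (h3 R)
  linarith

lemma MeasureTheory.Measure.AbsolutelyContinuous.pi_real {n : ℕ} {μ ν : Fin n → Measure ℝ}
    [∀ i, SigmaFinite (μ i)] [∀ i, SigmaFinite (ν i)] (h : ∀ i, μ i ≪ ν i) :
    Measure.pi μ ≪ Measure.pi ν := by
  induction n with
  | zero =>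
    rw [Measure.pi_of_empty, Measure.pi_of_empty]
  | succ n ih =>
    have hμ := (measurePreserving_piFinSuccAbove μ 0).symm
    have hν := (measurePreserving_piFinSuccAbove ν 0).symm
    rw [← hμ.map_eq, ← hν.map_eq]
    exact ((h 0).prod (ih fun i => h _)).map (MeasurableEquiv.measurable _)

lemma lintegral_gaussianReal_le (m : ℝ) {v : ℝ≥0} (hv : v ≠ 0) (f : ℝ → ℝ≥0∞) :
    ∫⁻ τ, f τ ∂gaussianReal m v ≤ ENNReal.ofReal (√v)⁻¹ * ∫⁻ τ, f τ := by
  have hv' : 0 < (v : ℝ) := NNReal.coe_pos.2 (pos_iff_ne_zero.2 hv)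
  rw [gaussianReal_of_var_ne_zero m hv, lintegral_withDensity_eq_lintegral_mul_non_measurable _
    (measurable_gaussianPDF m v) (Eventually.of_forall fun _ => gaussianPDF_lt_top),
    ← lintegral_const_mul' _ _ ENNReal.ofReal_ne_top]
  refine lintegral_mono fun τ => ?_
  simp only [Pi.mul_apply]
  gcongr
  refine ENNReal.ofReal_le_ofReal ?_
  rw [gaussianPDFReal_def]
  have h1 : Real.exp (-(τ - m) ^ 2 / (2 * v)) ≤ 1 :=
    Real.exp_le_one_iff.2 (by rw [neg_div]; exact neg_nonpos.2 (by positivity))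
  have h2 : (√(2 * Real.pi * v))⁻¹ ≤ (√(v : ℝ))⁻¹ := by
    gcongr
    nlinarith [Real.pi_gt_three]
  exact (mul_le_mul h2 h1 (Real.exp_pos _).le (by positivity)).trans_eq (mul_one _)

section GaussianIncrements

variable {Ω : Type*} [MeasurableSpace Ω] {P : Measure Ω}

lemma map_absolutelyContinuous_of_covariance {d : ℕ} [IsProbabilityMeasure P]
    {Y : Ω → EuclideanSpace ℝ (Fin d)} (hY : Measurable Y)
    (hG : HasGaussianLaw (fun ω i => Y ω i) P) {v : ℝ} (hv : 0 < v)
    (hcov : ∀ i j, cov[fun ω => Y ω i, fun ω => Y ω j; P] = if i = j then v else 0)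
    (w : EuclideanSpace ℝ (Fin d)) :
    P.map (fun ω => w + Y ω) ≪ volume := by
  have hYi : ∀ i, Measurable fun ω => Y ω i := fun i => by fun_prop
  have hind : iIndepFun (fun i ω => Y ω i) P :=
    HasGaussianLaw.iIndepFun_of_covariance_eq_zero (X := fun i ω => Y ω i) hG
      fun i j hij => by rw [hcov, if_neg hij]
  have hpi := (iIndepFun_iff_map_fun_eq_pi_map fun i => (hYi i).aemeasurable).1 hind
  have hac : P.map (fun ω i => Y ω i) ≪ volume := by
    rw [hpi, volume_pi]
    have : ∀ i, IsProbabilityMeasure (P.map fun ω => Y ω i) := fun i =>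
      Measure.isProbabilityMeasure_map (hYi i).aemeasurable
    refine Measure.AbsolutelyContinuous.pi_real fun i => ?_
    rw [(hG.eval i).map_eq_gaussianReal]
    refine gaussianReal_absolutelyContinuous _ ?_
    rw [← covariance_self (hYi i).aemeasurable, hcov, if_pos rfl]
    simpa using hv
  have h1 : P.map Y ≪ volume := by
    have h := (hac.map (PiLp.volume_preserving_toLp (Fin d)).measurable)
    rw [(PiLp.volume_preserving_toLp (Fin d)).map_eq,
      Measure.map_map (PiLp.volume_preserving_toLp (Fin d)).measurable
        (measurable_pi_lambda _ hYi)] at h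
    exact h
  have h2 := h1.map (measurable_const_add w)
  rwa [(measurePreserving_add_left volume w).map_eq,
    Measure.map_map (measurable_const_add w) hY] at h2

/-- A function controlled by diagonal increments of a bounded monotone function has small Gaussian
expectation. -/
lemma lintegral_gaussian_le_of_diagonal_increment {d : ℕ} (hd : 0 < d) [IsProbabilityMeasure P]
    {Y : Ω → EuclideanSpace ℝ (Fin d)} (hY : Measurable Y)
    (hG : HasGaussianLaw (fun ω i => Y ω i) P) {v : ℝ} (hv : 0 < v)
    (hcov : ∀ i j, cov[fun ω => Y ω i, fun ω => Y ω j; P] = if i = j then v else 0)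
    {g h : EuclideanSpace ℝ (Fin d) → ℝ} (hg : Measurable g) {K : ℝ} (hK : ∀ y, |h y| ≤ K)
    (hmono : ∀ y z : EuclideanSpace ℝ (Fin d), (∀ j, y j ≤ z j) → h y ≤ h z)
    {x : ℝ} (hx : 0 ≤ x) (hgh : ∀ᵐ y, g y ≤ h (y + diagVec d x) - h (y - diagVec d x))
    (w : EuclideanSpace ℝ (Fin d)) :
    ∫⁻ ω, ENNReal.ofReal (g (w + Y ω)) ∂P ≤ ENNReal.ofReal (4 * K * √d * x / √v) := by
  have hd' : (0 : ℝ) < d := Nat.cast_pos.2 hd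
  have hYi : ∀ i, Measurable fun ω => Y ω i := fun i => by fun_prop
  have hL2 : ∀ i, MemLp (fun ω => Y ω i) 2 P := fun i => (hG.eval i).memLp_two
  let ξ : Ω → ℝ := fun ω => (d : ℝ)⁻¹ * ∑ i, Y ω i
  let R : Fin d → Ω → ℝ := fun i ω => Y ω i - ξ ω
  have hξm : Measurable ξ := by fun_prop
  have hRm : ∀ i, Measurable (R i) := fun i => by fun_prop
  have hξ2 : MemLp ξ 2 P := (memLp_finsetSum _ fun i _ => hL2 i).const_mul _
  have hcYξ : ∀ i, cov[fun ω => Y ω i, ξ; P] = v / d := fun i => by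
    rw [covariance_const_mul_right, covariance_fun_sum_right hL2 (hL2 i)]
    simp [hcov, div_eq_inv_mul]
  have hcξ : cov[ξ, ξ; P] = v / d := by
    conv_lhs => rw [covariance_const_mul_left]
    rw [covariance_fun_sum_left hL2 hξ2]
    simp only [hcYξ, Finset.sum_const, Finset.card_univ, Fintype.card_fin, nsmul_eq_mul]
    field_simp
  have hjoint : HasGaussianLaw (fun ω => (fun i => R i ω, fun _ : Unit => ξ ω)) P := by
    let M : (Fin d → ℝ) →L[ℝ] ℝ := (d : ℝ)⁻¹ • ∑ i, ContinuousLinearMap.proj i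
    let L : (Fin d → ℝ) →L[ℝ] (Fin d → ℝ) × (Unit → ℝ) :=
      (ContinuousLinearMap.pi fun i => ContinuousLinearMap.proj i - M).prod
        (ContinuousLinearMap.pi fun _ => M)
    have hL : (fun ω => (fun i => R i ω, fun _ : Unit => ξ ω)) = fun ω => L fun i => Y ω i := by
      ext ω i <;> simp [L, M, R, ξ]
    rw [hL]
    exact hG.map_fun L
  have hind := HasGaussianLaw.indepFun_of_covariance_eval (X := R) (Y := fun _ : Unit => ξ) hjoint
    fun i _ => by rw [covariance_fun_sub_left (hL2 i) hξ2 hξ2, hcYξ, hcξ, sub_self]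
  have hind' : IndepFun (fun ω i => R i ω) ξ P :=
    hind.comp measurable_id (measurable_pi_apply ())
  have hRm' : Measurable fun ω i => R i ω := measurable_pi_lambda _ hRm
  have hprod := hind'.map_prod_eq_prod_map_map hRm'.aemeasurable hξm.aemeasurable
  have hξG : HasGaussianLaw ξ P := hjoint.snd.eval ()
  set ν := P.map ξ with hν
  set ρ := P.map fun ω i => R i ω with hρ
  have : IsProbabilityMeasure ρ := Measure.isProbabilityMeasure_map hRm'.aemeasurable
  have : IsProbabilityMeasure ν := Measure.isProbabilityMeasure_map hξm.aemeasurable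
  have hvar : Var[ξ; P].toNNReal = (v / d).toNNReal := by
    rw [← covariance_self hξm.aemeasurable, hcξ]
  have hvd : (v / d).toNNReal ≠ 0 := by simpa using div_pos hv hd'
  have hνeq : ν = gaussianReal P[ξ] (v / d).toNNReal := by
    rw [hν, hξG.map_eq_gaussianReal, hvar]
  let Φ : (Fin d → ℝ) × ℝ → EuclideanSpace ℝ (Fin d) := fun z => w + WithLp.toLp 2 z.1 + diagVec d z.2
  have hΦ : Measurable Φ :=
    (((PiLp.continuous_toLp 2 _).measurable.comp measurable_fst).const_add w).add
      ((measurable_diagVec d).comp measurable_snd)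
  have hΦY : ∀ ω, Φ (fun i => R i ω, ξ ω) = w + Y ω := fun ω => by
    ext i; simp [Φ, R, add_assoc]
  have hmap : (ρ.prod ν).map Φ = P.map fun ω => w + Y ω := by
    rw [← hprod, Measure.map_map hΦ (hRm'.prodMk hξm)]
    congr 1; ext1 ω; exact hΦY ω
  have hae : ∀ᵐ r ∂ρ, ∀ᵐ τ ∂ν,
      g (Φ (r, τ)) ≤ h (Φ (r, τ) + diagVec d x) - h (Φ (r, τ) - diagVec d x) := by
    have h0 := (map_absolutelyContinuous_of_covariance hY hG hv hcov w).ae_le hgh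
    rw [← hmap] at h0
    exact Measure.ae_ae_of_ae_prod (ae_of_ae_map hΦ.aemeasurable h0)
  have hgm : Measurable fun z => ENNReal.ofReal (g (Φ z)) := (hg.comp hΦ).ennreal_ofReal
  calc ∫⁻ ω, ENNReal.ofReal (g (w + Y ω)) ∂P
      = ∫⁻ z, ENNReal.ofReal (g (Φ z)) ∂(ρ.prod ν) := by
        rw [← hprod, lintegral_map hgm (hRm'.prodMk hξm)]
        simp_rw [hΦY]
    _ = ∫⁻ r, ∫⁻ τ, ENNReal.ofReal (g (Φ (r, τ))) ∂ν ∂ρ := lintegral_prod _ hgm.aemeasurable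
    _ ≤ ∫⁻ _, ENNReal.ofReal (4 * K * √d * x / √v) ∂ρ := by
        refine lintegral_mono_ae ?_
        filter_upwards [hae] with r hr
        let f : ℝ → ℝ := fun τ => h (Φ (r, τ))
        have hf : Monotone f := fun a b hab => hmono _ _ fun j => by simpa [Φ] using hab
        calc ∫⁻ τ, ENNReal.ofReal (g (Φ (r, τ))) ∂ν
            ≤ ∫⁻ τ, ENNReal.ofReal (f (τ + x) - f (τ - x)) ∂ν := by
              refine lintegral_mono_ae ?_
              filter_upwards [hr] with τ hτ
              refine ENNReal.ofReal_le_ofReal (hτ.trans_eq ?_)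
              have h1 : Φ (r, τ) + diagVec d x = Φ (r, τ + x) := by ext j; simp [Φ, add_assoc]
              have h2 : Φ (r, τ) - diagVec d x = Φ (r, τ - x) := by
                ext j; simp [Φ]; ring
              rw [h1, h2]
          _ ≤ ENNReal.ofReal (√(v / d).toNNReal)⁻¹ * ENNReal.ofReal (4 * K * x) := by
              rw [hνeq]
              refine (lintegral_gaussianReal_le _ hvd _).trans ?_
              gcongr
              exact lintegral_monotone_increment_le hf (fun τ => hK _) hx
          _ = _ := by
              rw [← ENNReal.ofReal_mul (by positivity), Real.coe_toNNReal _ (by positivity),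
                Real.sqrt_div hv.le, inv_div]
              congr 1; ring
    _ = _ := by simp

end GaussianIncrements

lemma intervalIntegrable_of_mem_Icc {G : ℝ → ℝ} (hG : Measurable G) {K : ℝ}
    (hK : ∀ t, G t ∈ Icc 0 K) (a b : ℝ) : IntervalIntegrable G volume a b :=
  (intervalIntegrable_const (c := K)).mono_fun hG.aestronglyMeasurable
    (Eventually.of_forall fun t => by
      beta_reduce
      rw [Real.norm_eq_abs, Real.norm_eq_abs, abs_of_nonneg (hK t).1]
      exact (hK t).2.trans (le_abs_self K))

/-- The first step of Khasminskii's expansion of an exponential functional. -/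
lemma ofReal_exp_setIntegral_le {G : ℝ → ℝ} (hG : Measurable G) {K : ℝ}
    (hK : ∀ t, G t ∈ Icc 0 K) {μ : ℝ} (hμ : 0 ≤ μ) {l T : ℝ} (hlT : l ≤ T) :
    ENNReal.ofReal (Real.exp (μ * ∫ q in Ioc l T, G q)) ≤
      1 + ∫⁻ t in Ioc l T, ENNReal.ofReal (μ * G t) *
        ENNReal.ofReal (Real.exp (μ * ∫ q in Ioc t T, G q)) := by
  have hint : ∀ a b, IntervalIntegrable G volume a b := intervalIntegrable_of_mem_Icc hG hK
  let F : ℝ → ℝ := fun t => ∫ q in T..t, G q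
  let f : ℝ → ℝ := fun t => Real.exp (-μ * F t)
  have hFL : LipschitzWith K.toNNReal F := by
    refine LipschitzWith.of_dist_le_mul fun s t => ?_
    rw [Real.dist_eq, Real.dist_eq, intervalIntegral.integral_interval_sub_left (hint _ _)
      (hint _ _), Real.coe_toNNReal _ ((hK 0).1.trans (hK 0).2)]
    refine intervalIntegral.norm_integral_le_of_norm_le_const (f := G) fun q _ => ?_
    rw [Real.norm_eq_abs, abs_of_nonneg (hK q).1]
    exact (hK q).2
  have hexp : LocallyLipschitz fun x : ℝ => Real.exp (-μ * x) :=
    ContDiff.locallyLipschitz (𝕂 := ℝ) (by fun_prop)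
  obtain ⟨L, hL⟩ := (((hexp.comp hFL.locallyLipschitz).locallyLipschitzOn
    (s := uIcc l T))).exists_lipschitzOnWith_of_compact isCompact_uIcc
  have hAC : AbsolutelyContinuousOnInterval f l T :=
    LipschitzOnWith.absolutelyContinuousOnInterval (f := f) hL
  have hderiv : ∀ᵐ t, t ∈ Ioc l T → deriv f t = -(μ * G t * f t) := by
    filter_upwards [(hint l T).ae_hasDerivAt_integral] with t ht htm
    have h := ht (by rw [uIcc_of_le hlT]; exact Ioc_subset_Icc_self htm) T (by simp)
    have := ((h.const_mul (-μ)).exp).deriv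
    rw [show deriv f t = _ from this]
    simp only [f, F]
    ring
  have hIoc : ∀ t ≤ T, f t = Real.exp (μ * ∫ q in Ioc t T, G q) := fun t ht => by
    simp only [f, F]
    rw [intervalIntegral.integral_symm, intervalIntegral.integral_of_le ht]
    ring_nf
  have hfc : Continuous f := Real.continuous_exp.comp (hFL.continuous.const_mul _)
  have hfT : f T = 1 := by simp [f, F]
  have hmain := hAC.integral_deriv_eq_sub
  rw [intervalIntegral.integral_of_le hlT, setIntegral_congr_ae measurableSet_Ioc hderiv,
    integral_neg, hfT] at hmain
  have hintf : IntegrableOn (fun t => μ * G t * f t) (Ioc l T) :=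
    (((hint l T).const_mul μ).mul_continuousOn hfc.continuousOn).1
  have hnn : ∀ t, 0 ≤ μ * G t * f t := fun t =>
    mul_nonneg (mul_nonneg hμ (hK t).1) (Real.exp_pos _).le
  rw [← hIoc l hlT, show f l = 1 + ∫ t in Ioc l T, μ * G t * f t by linarith,
    ENNReal.ofReal_add zero_le_one (integral_nonneg hnn), ENNReal.ofReal_one,
    ofReal_integral_eq_lintegral_ofReal hintf (Eventually.of_forall hnn)]
  gcongr 1 + ?_
  refine setLIntegral_mono_ae' measurableSet_Ioc (Eventually.of_forall fun t ht => ?_)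
  rw [← hIoc t ht.2, ENNReal.ofReal_mul (mul_nonneg hμ (hK t).1)]

lemma lintegral_exp_neg_div_sqrt_le {κ : ℝ} (hκ : 0 < κ) (c l T : ℝ) (hc : 0 ≤ c) :
    ∫⁻ t in Ioc l T, ENNReal.ofReal (c / √(t - l) * Real.exp (-(κ * (t - l)))) ≤
      ENNReal.ofReal (c * √(Real.pi / κ)) := by
  have hI : ∫ t in Ioi (0 : ℝ), c / √t * Real.exp (-(κ * t)) = c * √(Real.pi / κ) := by
    have h := Real.integral_rpow_mul_exp_neg_mul_Ioi (a := 1 / 2) (by norm_num) hκ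
    rw [Real.Gamma_one_half_eq, ← Real.sqrt_eq_rpow, ← Real.sqrt_mul (by positivity)] at h
    rw [show Real.pi / κ = 1 / κ * Real.pi by ring, ← h, ← integral_const_mul]
    refine setIntegral_congr_fun measurableSet_Ioi fun t ht => ?_
    have ht' : (0 : ℝ) < t := ht
    rw [Real.sqrt_eq_rpow, show (1 / 2 - 1 : ℝ) = -(1 / 2) by norm_num, Real.rpow_neg ht'.le]
    ring
  have hint : c ≠ 0 → IntegrableOn (fun t => c / √t * Real.exp (-(κ * t))) (Ioi (0 : ℝ)) := by
    intro hc0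
    by_contra hcon
    rw [integral_undef hcon] at hI
    have : 0 < c * √(Real.pi / κ) := by
      have := Real.pi_pos
      have := lt_of_le_of_ne hc (Ne.symm hc0)
      positivity
    linarith
  rcases eq_or_ne c 0 with rfl | hc0
  · simp
  calc ∫⁻ t in Ioc l T, ENNReal.ofReal (c / √(t - l) * Real.exp (-(κ * (t - l))))
      ≤ ∫⁻ t in Ioi l, ENNReal.ofReal (c / √(t - l) * Real.exp (-(κ * (t - l)))) :=
        lintegral_mono_set Ioc_subset_Ioi_self
    _ = ∫⁻ t in Ioi (0 : ℝ), ENNReal.ofReal (c / √t * Real.exp (-(κ * t))) := by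
        have h := (measurePreserving_sub_right volume l).setLIntegral_comp_preimage_emb
          (MeasurableEquiv.subRight l).measurableEmbedding
          (fun t => ENNReal.ofReal (c / √t * Real.exp (-(κ * t)))) (Ioi (0 : ℝ))
        rw [← h]
        congr 2
        ext t; simp
    _ = _ := by
        rw [← ofReal_integral_eq_lintegral_ofReal (hint hc0)
          (ae_restrict_of_forall_mem measurableSet_Ioi fun t _ => by positivity), hI]

lemma ProbabilityTheory.IndepFun.lintegral_comp_prod {Ω : Type*} [MeasurableSpace Ω] {P : Measure Ω}
    [IsProbabilityMeasure P] {α β : Type*} [MeasurableSpace α] [MeasurableSpace β]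
    {X : Ω → α} {Z : Ω → β} (hX : Measurable X) (hZ : Measurable Z) (h : IndepFun X Z P)
    {H : α × β → ℝ≥0∞} (hH : Measurable H) :
    ∫⁻ ω, H (X ω, Z ω) ∂P = ∫⁻ ω', ∫⁻ ω, H (X ω', Z ω) ∂P ∂P := by
  have h1 := h.map_prod_eq_prod_map_map hX.aemeasurable hZ.aemeasurable
  have : IsProbabilityMeasure (P.map Z) := Measure.isProbabilityMeasure_map hZ.aemeasurable
  rw [← lintegral_map hH (hX.prodMk hZ), h1, lintegral_prod _ hH.aemeasurable,
    lintegral_map hH.lintegral_prod_right' hX]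
  refine lintegral_congr fun ω' => ?_
  exact lintegral_map (hH.comp measurable_prodMk_left) hZ

/-- Integration of a function of `X` and of the path of an independent continuous process. -/
lemma lintegral_indep_process {Ω : Type*} [MeasurableSpace Ω] {P : Measure Ω}
    [IsProbabilityMeasure P] {α ι : Type*} [MeasurableSpace α] {E : Type*} [MeasurableSpace E]
    {X : Ω → α} {Z : ι → Ω → E} (hX : Measurable X) (hZ : ∀ q, Measurable (Z q))
    (h : IndepFun X (fun ω q => Z q ω) P) {H : α × Ω → ℝ≥0∞}
    (hH : @Measurable (α × Ω) ℝ≥0∞ (@Prod.instMeasurableSpace α Ω _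
      (MeasurableSpace.comap (fun ω q => Z q ω) MeasurableSpace.pi)) _ H) :
    ∫⁻ ω, H (X ω, ω) ∂P = ∫⁻ ω', ∫⁻ ω, H (X ω', ω) ∂P ∂P := by
  have hle : MeasurableSpace.comap (fun ω q => Z q ω) MeasurableSpace.pi ≤ ‹MeasurableSpace Ω› :=
    (measurable_pi_lambda _ hZ).comap_le
  refine @ProbabilityTheory.IndepFun.lintegral_comp_prod Ω _ P _ α Ω _
    (MeasurableSpace.comap (fun ω q => Z q ω) MeasurableSpace.pi) X id hX
    (measurable_id.mono le_rfl hle) ?_ H hH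
  refine (IndepFun_iff_Indep (mγ := MeasurableSpace.comap (fun ω q => Z q ω)
    MeasurableSpace.pi) X id P).2 ?_
  rw [MeasurableSpace.comap_id]
  exact (IndepFun_iff_Indep _ _ _).1 h

/-- A continuous process whose increments are independent of the future, in `[0, ∞)`. -/
structure IsIndepIncrementProcess {Ω : Type*} [MeasurableSpace Ω] (P : Measure Ω) {E : Type*}
    [NormedAddCommGroup E] [MeasurableSpace E] (V : ℝ → Ω → E) : Prop where
  meas : ∀ t, Measurable (V t)
  cont : ∀ ω, Continuous fun t => V t ω
  zero : ∀ ω, V 0 ω = 0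
  indep : ∀ r t, 0 ≤ r → r ≤ t →
    IndepFun (fun ω => V t ω - V r ω) (fun ω (q : Ici t) => V q ω - V t ω) P

section Khasminskii

variable {Ω : Type*} [MeasurableSpace Ω] {P : Measure Ω} [IsProbabilityMeasure P] {E : Type*}
  [NormedAddCommGroup E] [MeasurableSpace E] [BorelSpace E] [SecondCountableTopology E]
  {V : ℝ → Ω → E} {g : ℝ × E → ℝ} {K μ T : ℝ}

lemma measurable_setIntegral_Ioc {α : Type*} [MeasurableSpace α] {f : ℝ × α → ℝ} (hf : Measurable f)
    (T : ℝ) : Measurable fun z : ℝ × α => ∫ q in Ioc z.1 T, f (q, z.2) := by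
  have h1 : ∀ z : ℝ × α, ∫ q in Ioc z.1 T, f (q, z.2) =
      ∫ q, {w : (ℝ × α) × ℝ | w.1.1 < w.2 ∧ w.2 ≤ T}.indicator (fun w => f (w.2, w.1.2)) (z, q) := by
    intro z
    rw [← integral_indicator measurableSet_Ioc]
    rfl
  simp_rw [h1]
  have hS : MeasurableSet {w : (ℝ × α) × ℝ | w.1.1 < w.2 ∧ w.2 ≤ T} :=
    (measurableSet_lt measurable_fst.fst measurable_snd).inter
      (measurableSet_le measurable_snd measurable_const)
  have hm : Measurable ({w : (ℝ × α) × ℝ | w.1.1 < w.2 ∧ w.2 ≤ T}.indicator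
      (fun w => f (w.2, w.1.2))) :=
    (hf.comp (measurable_snd.prodMk measurable_fst.snd)).indicator hS
  exact hm.stronglyMeasurable.integral_prod_right'.measurable

/-- One step of the Markov expansion of an exponential functional. -/
lemma lintegral_exp_functional_le (hV : IsIndepIncrementProcess P V) (hg : Measurable g)
    (hgK : ∀ z, g z ∈ Icc 0 K) (hμ : 0 ≤ μ) {a : ℝ}
    (hga : ∀ᵐ t, ∀ r, 0 ≤ r → r < t → t ≤ T → ∀ w,
      ∫⁻ ω, ENNReal.ofReal (g (t, w + (V t ω - V r ω))) ∂P ≤ ENNReal.ofReal (a / √(t - r)))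
    {r l : ℝ} (hr : 0 ≤ r) (hrl : r ≤ l) (hlT : l ≤ T) (w : E) {B : ℝ → ℝ≥0∞}
    (hB : ∀ t ∈ Ioc l T, ∀ y, ∫⁻ ω, ENNReal.ofReal
      (Real.exp (μ * ∫ q in Ioc t T, g (q, y + (V q ω - V t ω)))) ∂P ≤ B t) :
    ∫⁻ ω, ENNReal.ofReal (Real.exp (μ * ∫ q in Ioc l T, g (q, w + (V q ω - V r ω)))) ∂P ≤
      1 + ∫⁻ t in Ioc l T, ENNReal.ofReal (μ * a / √(t - r)) * B t := by
  have hVc := hV.cont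
  have hVm : Measurable fun z : ℝ × Ω => V z.1 z.2 :=
    measurable_uncurry_of_continuous_of_measurable hV.cont hV.meas
  have hGm : Measurable fun z : ℝ × Ω => g (z.1, w + (V z.1 z.2 - V r z.2)) :=
    hg.comp (measurable_fst.prodMk
      ((hVm.sub ((hV.meas r).comp measurable_snd)).const_add w))
  have hFm := measurable_setIntegral_Ioc hGm T
  have hprodm : Measurable fun z : ℝ × Ω =>
      ENNReal.ofReal (μ * g (z.1, w + (V z.1 z.2 - V r z.2))) *
        ENNReal.ofReal (Real.exp (μ * ∫ q in Ioc z.1 T, g (q, w + (V q z.2 - V r z.2)))) :=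
    (hGm.const_mul μ).ennreal_ofReal.mul
      (Real.measurable_exp.comp (hFm.const_mul μ)).ennreal_ofReal
  calc ∫⁻ ω, ENNReal.ofReal (Real.exp (μ * ∫ q in Ioc l T, g (q, w + (V q ω - V r ω)))) ∂P
      ≤ ∫⁻ ω, (1 + ∫⁻ t in Ioc l T, ENNReal.ofReal (μ * g (t, w + (V t ω - V r ω))) *
        ENNReal.ofReal (Real.exp (μ * ∫ q in Ioc t T, g (q, w + (V q ω - V r ω))))) ∂P :=
        lintegral_mono fun ω => ofReal_exp_setIntegral_le
          (hGm.comp (measurable_prodMk_right (y := ω))) (fun t => hgK _) hμ hlT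
    _ = 1 + ∫⁻ t in Ioc l T, ∫⁻ ω, ENNReal.ofReal (μ * g (t, w + (V t ω - V r ω))) *
        ENNReal.ofReal (Real.exp (μ * ∫ q in Ioc t T, g (q, w + (V q ω - V r ω)))) ∂P := by
        rw [lintegral_add_left measurable_const, lintegral_lintegral_swap]
        · simp
        · exact (hprodm.comp measurable_swap).aemeasurable
    _ ≤ _ := by
        gcongr 1 + ?_
        refine setLIntegral_mono_ae' measurableSet_Ioc ?_
        filter_upwards [hga] with t ht htm
        have hrt : r < t := hrl.trans_lt htm.1
        let Z : Ici t → Ω → E := fun q ω => V q ω - V t ω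
        let H : E × Ω → ℝ≥0∞ := fun z => ENNReal.ofReal (μ * g (t, w + z.1)) *
          ENNReal.ofReal (Real.exp (μ * ∫ q in Ioc t T,
            g (q, w + z.1 + (V (max q t) z.2 - V t z.2))))
        have hHeq : ∀ y ω, H (y, ω) = ENNReal.ofReal (μ * g (t, w + y)) *
            ENNReal.ofReal (Real.exp (μ * ∫ q in Ioc t T, g (q, w + y + (V q ω - V t ω)))) := by
          intro y ω
          simp only [H]
          congr 4
          refine setIntegral_congr_fun measurableSet_Ioc fun q hq => ?_
          simp only [max_eq_left hq.1.le]
        have hHm : @Measurable (E × Ω) ℝ≥0∞ (@Prod.instMeasurableSpace E Ω _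
            (MeasurableSpace.comap (fun ω q => Z q ω) MeasurableSpace.pi)) _ H := by
          let m' : MeasurableSpace Ω :=
            MeasurableSpace.comap (fun ω q => Z q ω) MeasurableSpace.pi
          have hU : Measurable fun z : ℝ × Ω => V (max z.1 t) z.2 - V t z.2 := by
            refine measurable_uncurry_of_continuous_of_measurable
              (u := fun q ω => V (max q t) ω - V t ω) (fun ω => ?_) (fun q => ?_)
            · exact ((hVc ω).comp (continuous_id.max continuous_const)).sub continuous_const
            · exact (measurable_pi_apply (⟨max q t, mem_Ici.2 (le_max_right q t)⟩ : Ici t)).comp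
                (comap_measurable fun ω q => Z q ω)
          have hin : Measurable fun z : ℝ × (E × Ω) =>
              g (z.1, w + z.2.1 + (V (max z.1 t) z.2.2 - V t z.2.2)) := by
            refine hg.comp (measurable_fst.prodMk (Measurable.add (by fun_prop) ?_))
            exact hU.comp (measurable_fst.prodMk (measurable_snd.comp measurable_snd))
          have hI := (measurable_setIntegral_Ioc hin T).comp
            (measurable_const.prodMk measurable_id : Measurable fun z : E × Ω => (t, z))
          have h1 : Measurable fun z : E × Ω => g (t, w + z.1) := by fun_prop
          exact (h1.const_mul μ).ennreal_ofReal.mul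
            (Real.measurable_exp.comp (hI.const_mul μ)).ennreal_ofReal
        have hind := lintegral_indep_process (Z := Z) ((hV.meas t).sub (hV.meas r))
          (fun q => (hV.meas q).sub (hV.meas t)) (hV.indep r t hr hrt.le) hHm
        calc ∫⁻ ω, ENNReal.ofReal (μ * g (t, w + (V t ω - V r ω))) *
              ENNReal.ofReal (Real.exp (μ * ∫ q in Ioc t T, g (q, w + (V q ω - V r ω)))) ∂P
            = ∫⁻ ω, H (V t ω - V r ω, ω) ∂P := by
              refine lintegral_congr fun ω => ?_
              rw [hHeq]
              have : ∀ q, w + (V q ω - V r ω) = w + (V t ω - V r ω) + (V q ω - V t ω) := by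
                intro q; abel
              simp_rw [← this]
          _ = ∫⁻ ω', ∫⁻ ω, H (V t ω' - V r ω', ω) ∂P ∂P := hind
          _ ≤ ∫⁻ ω', ENNReal.ofReal (μ * g (t, w + (V t ω' - V r ω'))) * B t ∂P := by
              refine lintegral_mono fun ω' => ?_
              simp_rw [hHeq]
              rw [lintegral_const_mul' _ _ ENNReal.ofReal_ne_top]
              gcongr
              exact hB t htm _
          _ = (∫⁻ ω', ENNReal.ofReal (μ * g (t, w + (V t ω' - V r ω'))) ∂P) * B t := by
              refine lintegral_mul_const _ ?_
              exact ((hGm.comp measurable_prodMk_left).const_mul μ).ennreal_ofReal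
          _ ≤ _ := by
              gcongr
              simp_rw [ENNReal.ofReal_mul hμ]
              rw [lintegral_const_mul' _ _ ENNReal.ofReal_ne_top, mul_div_assoc,
                ENNReal.ofReal_mul hμ]
              gcongr
              exact ht r hr hrt htm.2 w

lemma lintegral_kernel_le {c κ : ℝ} (hc : 0 < c) (hκ : κ = 4 * Real.pi * c ^ 2) {r l : ℝ}
    (hrl : r ≤ l) (M : ℝ≥0∞) :
    ∫⁻ t in Ioc l T, ENNReal.ofReal (c / √(t - r)) * (M * ENNReal.ofReal (Real.exp (κ * (T - t)))) ≤
      M * ENNReal.ofReal (Real.exp (κ * (T - l))) * 2⁻¹ := by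
  have hκ0 : 0 < κ := by rw [hκ]; positivity
  have hhalf : c * √(Real.pi / κ) = 2⁻¹ := by
    rw [hκ, show Real.pi / (4 * Real.pi * c ^ 2) = ((2 * c)⁻¹) ^ 2 by
      field_simp; norm_num, Real.sqrt_sq (by positivity)]
    field_simp
  calc _ ≤ ∫⁻ t in Ioc l T, M * ENNReal.ofReal (Real.exp (κ * (T - l))) *
        ENNReal.ofReal (c / √(t - l) * Real.exp (-(κ * (t - l)))) := by
        refine setLIntegral_mono_ae' measurableSet_Ioc (Eventually.of_forall fun t ht => ?_)
        have h0 : 0 < √(t - l) := Real.sqrt_pos.2 (sub_pos.2 ht.1)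
        have h1 : c / √(t - r) ≤ c / √(t - l) := by
          gcongr
        have h2 : Real.exp (κ * (T - t)) =
            Real.exp (κ * (T - l)) * Real.exp (-(κ * (t - l))) := by
          rw [← Real.exp_add]; ring_nf
        rw [h2, ENNReal.ofReal_mul (Real.exp_pos _).le, ENNReal.ofReal_mul (by positivity)]
        calc _ ≤ ENNReal.ofReal (c / √(t - l)) * (M * (ENNReal.ofReal (Real.exp (κ * (T - l))) *
              ENNReal.ofReal (Real.exp (-(κ * (t - l)))))) := by gcongr
          _ = _ := by ring
    _ ≤ M * ENNReal.ofReal (Real.exp (κ * (T - l))) * 2⁻¹ := by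
        have hm : Measurable fun t => ENNReal.ofReal (c / √(t - l) * Real.exp (-(κ * (t - l)))) := by
          fun_prop
        rw [lintegral_const_mul _ hm]
        gcongr
        refine (lintegral_exp_neg_div_sqrt_le hκ0 c l T hc.le).trans_eq ?_
        rw [hhalf, ENNReal.ofReal_inv_of_pos two_pos]
        simp

/-- Khasminskii's bound for exponential functionals of a process with independent increments. -/
lemma lintegral_exp_functional_le_two_mul (hV : IsIndepIncrementProcess P V) (hg : Measurable g)
    (hgK : ∀ z, g z ∈ Icc 0 K) (hμ : 0 < μ) {a : ℝ} (ha : 0 < a)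
    (hga : ∀ᵐ t, ∀ r, 0 ≤ r → r < t → t ≤ T → ∀ w,
      ∫⁻ ω, ENNReal.ofReal (g (t, w + (V t ω - V r ω))) ∂P ≤ ENNReal.ofReal (a / √(t - r)))
    {l : ℝ} (hl : 0 ≤ l) (hlT : l ≤ T) :
    ∫⁻ ω, ENNReal.ofReal (Real.exp (μ * ∫ q in Ioc l T, g (q, V q ω))) ∂P ≤
      2 * ENNReal.ofReal (Real.exp (4 * Real.pi * (μ * a) ^ 2 * (T - l))) := by
  set κ := 4 * Real.pi * (μ * a) ^ 2 with hκ
  have hκ0 : 0 < κ := by rw [hκ]; positivity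
  have hc : 0 < μ * a := mul_pos hμ ha
  have hK0 : 0 ≤ K := (hgK 0).1.trans (hgK 0).2
  let φ : ℝ → E → ℝ≥0∞ := fun t y =>
    ∫⁻ ω, ENNReal.ofReal (Real.exp (μ * ∫ q in Ioc t T, g (q, y + (V q ω - V t ω)))) ∂P
  let M : ℝ≥0∞ := ⨆ t ∈ Icc 0 T, ⨆ y, φ t y * ENNReal.ofReal (Real.exp (-(κ * (T - t))))
  have hcancel : ∀ t, ENNReal.ofReal (Real.exp (-(κ * (T - t)))) *
      ENNReal.ofReal (Real.exp (κ * (T - t))) = 1 := fun t => by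
    rw [← ENNReal.ofReal_mul (Real.exp_pos _).le, ← Real.exp_add]; simp
  have hle1 : ∀ t ≤ T, ENNReal.ofReal (Real.exp (-(κ * (T - t)))) ≤ 1 := fun t ht => by
    rw [ENNReal.ofReal_le_one, Real.exp_le_one_iff]
    have := mul_nonneg hκ0.le (sub_nonneg.2 ht); linarith
  have hφM : ∀ t ∈ Icc 0 T, ∀ y, φ t y ≤ M * ENNReal.ofReal (Real.exp (κ * (T - t))) := by
    intro t ht y
    calc φ t y = φ t y * ENNReal.ofReal (Real.exp (-(κ * (T - t)))) *
          ENNReal.ofReal (Real.exp (κ * (T - t))) := by rw [mul_assoc, hcancel, mul_one]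
      _ ≤ _ := by
        gcongr
        exact le_iSup₂_of_le t ht (le_iSup_of_le y le_rfl)
  have hstep : ∀ r l', 0 ≤ r → r ≤ l' → l' ≤ T → ∀ w,
      ∫⁻ ω, ENNReal.ofReal (Real.exp (μ * ∫ q in Ioc l' T, g (q, w + (V q ω - V r ω)))) ∂P ≤
        1 + M * ENNReal.ofReal (Real.exp (κ * (T - l'))) * 2⁻¹ := fun r l' hr hrl' hl' w =>
    (lintegral_exp_functional_le hV hg hgK hμ.le hga hr hrl' hl' w fun t ht y =>
      hφM t ⟨(hr.trans hrl').trans ht.1.le, ht.2⟩ y).trans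
        (by gcongr 1 + ?_; exact lintegral_kernel_le hc hκ hrl' M)
  have hMfin : M ≠ ∞ := by
    refine ne_top_of_le_ne_top (b := ENNReal.ofReal (Real.exp (μ * (K * T)))) ENNReal.ofReal_ne_top
      (iSup₂_le fun t ht => iSup_le fun y => ?_)
    refine (mul_le_of_le_one_right' (hle1 t ht.2)).trans ?_
    have : ∀ ω, ENNReal.ofReal (Real.exp (μ * ∫ q in Ioc t T, g (q, y + (V q ω - V t ω)))) ≤
        ENNReal.ofReal (Real.exp (μ * (K * T))) := by
      intro ω
      gcongr
      have h := norm_setIntegral_le_of_norm_le_const (μ := volume) (s := Ioc t T) (C := K)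
        (f := fun q => g (q, y + (V q ω - V t ω))) (by simp) fun q _ => by
          rw [Real.norm_eq_abs, abs_of_nonneg (hgK _).1]; exact (hgK _).2
      rw [Real.volume_real_Ioc_of_le ht.2] at h
      refine (le_abs_self _).trans (h.trans ?_)
      gcongr
      linarith [ht.1]
    calc φ t y ≤ ∫⁻ _, ENNReal.ofReal (Real.exp (μ * (K * T))) ∂P := lintegral_mono this
      _ = _ := by simp
  have hM1 : M ≤ 1 + M * 2⁻¹ := by
    refine iSup₂_le fun t ht => iSup_le fun y => ?_
    calc φ t y * ENNReal.ofReal (Real.exp (-(κ * (T - t))))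
        ≤ (1 + M * ENNReal.ofReal (Real.exp (κ * (T - t))) * 2⁻¹) *
          ENNReal.ofReal (Real.exp (-(κ * (T - t)))) := by
          gcongr
          exact hstep t t ht.1 le_rfl ht.2 y
      _ = ENNReal.ofReal (Real.exp (-(κ * (T - t)))) + M * 2⁻¹ *
          (ENNReal.ofReal (Real.exp (-(κ * (T - t)))) * ENNReal.ofReal (Real.exp (κ * (T - t)))) := by
          ring
      _ ≤ 1 + M * 2⁻¹ := by
          rw [hcancel, mul_one]
          gcongr
          exact hle1 t ht.2
  have hM2 : M ≤ 2 := by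
    lift M to ℝ≥0 using hMfin with m
    rw [show (2⁻¹ : ℝ≥0∞) = ((2⁻¹ : ℝ≥0) : ℝ≥0∞) by simp] at hM1
    norm_cast at hM1 ⊢
    have : (m : ℝ) ≤ 1 + m * 2⁻¹ := by exact_mod_cast hM1
    have : (m : ℝ) ≤ 2 := by linarith
    exact_mod_cast this
  have hfinal := hstep 0 l le_rfl hl hlT 0
  simp only [hV.zero, sub_zero, zero_add] at hfinal
  have h1 : (1 : ℝ≥0∞) ≤ ENNReal.ofReal (Real.exp (κ * (T - l))) := by
    rw [ENNReal.one_le_ofReal, Real.one_le_exp_iff]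
    exact mul_nonneg hκ0.le (sub_nonneg.2 hlT)
  calc _ ≤ 1 + M * ENNReal.ofReal (Real.exp (κ * (T - l))) * 2⁻¹ := hfinal
    _ ≤ ENNReal.ofReal (Real.exp (κ * (T - l))) +
        2 * ENNReal.ofReal (Real.exp (κ * (T - l))) * 2⁻¹ := by gcongr
    _ = _ := by
        have h2 : ∀ x : ℝ≥0∞, x + 2 * x * 2⁻¹ = 2 * x := fun x => by
          rw [mul_comm 2 x, mul_assoc, ENNReal.mul_inv_cancel two_ne_zero ENNReal.ofNat_ne_top,
            mul_one, mul_two]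
        exact h2 _

end Khasminskii

section Sheet

variable {Ω : Type*} [MeasurableSpace Ω] {P : Measure Ω} {d : ℕ}
  {W : ℝ × ℝ → Ω → EuclideanSpace ℝ (Fin d)}

lemma IsBrownianSheet.measurable_apply (hW : IsBrownianSheet P d W) (p : ℝ × ℝ) (i : Fin d) :
    Measurable fun ω => W p ω i :=
  (EuclideanSpace.proj (𝕜 := ℝ) i).continuous.measurable.comp (hW.1 p)

/-- The coordinates of a Brownian sheet form a Gaussian process. -/
lemma IsBrownianSheet.isGaussianProcess (hW : IsBrownianSheet P d W) :
    IsGaussianProcess (fun (x : Icc (0 : ℝ × ℝ) 1 × Fin d) ω => W x.1 ω x.2) P where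
  hasGaussianLaw I := by
    refine ⟨isGaussian_of_map_eq_gaussianReal fun L => ?_⟩
    have hm : Measurable fun ω => I.restrict
        (fun x : Icc (0 : ℝ × ℝ) 1 × Fin d => W x.1 ω x.2) :=
      measurable_pi_lambda _ fun x => hW.measurable_apply _ _
    rw [Measure.map_map (by fun_prop) hm]
    let e := I.equivFin.symm
    have h := hW.2.2.2 I.card (fun k => (e k).1.1) (fun k => (e k).1.2)
      (fun k => L (Pi.single (e k) 1)) (fun k => (e k).1.1.2)
    refine ⟨_, _, Eq.trans ?_ h⟩
    congr 1
    ext ω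
    classical
    have hL : ∀ f : I → ℝ, L f = ∑ x, L (Pi.single x 1) * f x := fun f => by
      conv_lhs => rw [← Finset.univ_sum_single f]
      rw [map_sum]
      refine Finset.sum_congr rfl fun x _ => ?_
      rw [mul_comm, ← smul_eq_mul, ← map_smul]
      congr 1
      ext y
      by_cases hy : y = x
      · subst hy; simp
      · simp [hy]
    rw [Function.comp_apply, hL]
    exact (e.sum_comp (fun x : I => L (Pi.single x 1) * W x.1.1 ω x.1.2)).symm

lemma IsBrownianSheet.memLp (hW : IsBrownianSheet P d W) {p : ℝ × ℝ} (hp : p ∈ Icc (0 : ℝ × ℝ) 1)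
    (i : Fin d) : MemLp (fun ω => W p ω i) 2 P :=
  (hW.isGaussianProcess.hasGaussianLaw_eval (⟨p, hp⟩, i)).memLp_two

lemma IsBrownianSheet.covariance_apply [IsProbabilityMeasure P] (hW : IsBrownianSheet P d W)
    {p q : ℝ × ℝ} (hp : p ∈ Icc (0 : ℝ × ℝ) 1) (hq : q ∈ Icc (0 : ℝ × ℝ) 1) (i j : Fin d) :
    cov[fun ω => W p ω i, fun ω => W q ω j; P] =
      if i = j then min p.1 q.1 * min p.2 q.2 else 0 := by
  have key : ∀ {n : ℕ} (p : Fin n → ℝ × ℝ) (idx : Fin n → Fin d),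
      (∀ j, p j ∈ Icc (0 : ℝ × ℝ) 1) → Var[fun ω => ∑ j, W (p j) ω (idx j); P] =
        ∑ j, ∑ k, if idx j = idx k then min (p j).1 (p k).1 * min (p j).2 (p k).2 else 0 := by
    intro n p idx hp
    have h := hW.2.2.2 n p idx (fun _ => 1) hp
    simp only [one_mul] at h
    have hm : Measurable fun ω => ∑ j, W (p j) ω (idx j) :=
      Finset.measurable_sum _ fun j _ => hW.measurable_apply _ _
    have h2 := variance_id_map (μ := P) hm.aemeasurable
    rw [← h2, h, variance_id_gaussianReal, Real.coe_toNNReal]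
    refine Finset.sum_nonneg fun a _ => Finset.sum_nonneg fun b _ => ?_
    split_ifs
    · exact mul_nonneg (le_min (hp a).1.1 (hp b).1.1) (le_min (hp a).1.2 (hp b).1.2)
    · exact le_rfl
  have hp1 := key ![p] ![i] (by simpa using hp)
  have hq1 := key ![q] ![j] (by simpa using hq)
  have hpq := key ![p, q] ![i, j] (by
    intro a
    fin_cases a
    · exact hp
    · exact hq)
  simp only [Fin.sum_univ_two, Fin.sum_univ_one, Matrix.cons_val_zero, Matrix.cons_val_one,
    Matrix.cons_val_fin_one, if_true, min_self] at hp1 hq1 hpq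
  rw [variance_fun_add (hW.memLp hp i) (hW.memLp hq j), hp1, hq1] at hpq
  replace hpq : p.1 * p.2 + 2 * cov[fun ω => W p ω i, fun ω => W q ω j; P] + q.1 * q.2 =
      p.1 * p.2 + (if i = j then min p.1 q.1 * min p.2 q.2 else 0) +
        ((if j = i then min q.1 p.1 * min q.2 p.2 else 0) + q.1 * q.2) := hpq
  simp only [eq_comm (a := j), min_comm q.1, min_comm q.2] at hpq
  linarith

/-- The path of the sheet along the vertical line through `s`, stopped outside `[0, 1]`. -/
def sheetPath (W : ℝ × ℝ → Ω → EuclideanSpace ℝ (Fin d)) (s t : ℝ) (ω : Ω) :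
    EuclideanSpace ℝ (Fin d) :=
  W (s, projIcc 0 1 zero_le_one t) ω

lemma mem_unitSquare {s : ℝ} (hs : s ∈ Icc (0 : ℝ) 1) (t : ℝ) :
    (s, (projIcc (0 : ℝ) 1 zero_le_one t : ℝ)) ∈ Icc (0 : ℝ × ℝ) 1 :=
  ⟨⟨hs.1, (projIcc (0 : ℝ) 1 zero_le_one t).2.1⟩, ⟨hs.2, (projIcc (0 : ℝ) 1 zero_le_one t).2.2⟩⟩

lemma IsBrownianSheet.isGaussianProcess_increment (hW : IsBrownianSheet P d W) {s : ℝ}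
    (hs : s ∈ Icc (0 : ℝ) 1) :
    IsGaussianProcess (fun (x : ℝ × ℝ × Fin d) ω =>
      sheetPath W s x.1 ω x.2.2 - sheetPath W s x.2.1 ω x.2.2) P := by
  classical
  refine hW.isGaussianProcess.of_isGaussianProcess fun x => ?_
  refine ⟨{(⟨_, mem_unitSquare hs x.1⟩, x.2.2), (⟨_, mem_unitSquare hs x.2.1⟩, x.2.2)},
    ContinuousLinearMap.proj (R := ℝ) ⟨_, Finset.mem_insert_self _ _⟩ -
      ContinuousLinearMap.proj (R := ℝ)
        ⟨_, Finset.mem_insert_of_mem (Finset.mem_singleton_self _)⟩, fun ω => rfl⟩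

lemma IsBrownianSheet.covariance_increment [IsProbabilityMeasure P] (hW : IsBrownianSheet P d W)
    {s : ℝ} (hs : s ∈ Icc (0 : ℝ) 1) {r t r' t' : ℝ} (i j : Fin d) :
    cov[fun ω => sheetPath W s t ω i - sheetPath W s r ω i,
      fun ω => sheetPath W s t' ω j - sheetPath W s r' ω j; P] =
      if i = j then s * (min (projIcc (0 : ℝ) 1 zero_le_one t : ℝ) (projIcc (0 : ℝ) 1 zero_le_one t')
        - min (projIcc (0 : ℝ) 1 zero_le_one t : ℝ) (projIcc (0 : ℝ) 1 zero_le_one r')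
        - min (projIcc (0 : ℝ) 1 zero_le_one r : ℝ) (projIcc (0 : ℝ) 1 zero_le_one t')
        + min (projIcc (0 : ℝ) 1 zero_le_one r : ℝ) (projIcc (0 : ℝ) 1 zero_le_one r')) else 0 := by
  have h := fun t => mem_unitSquare hs t
  unfold sheetPath
  rw [covariance_fun_sub_fun_sub (hW.memLp (h _) _) (hW.memLp (h _) _) (hW.memLp (h _) _)
    (hW.memLp (h _) _)]
  simp only [hW.covariance_apply (h _) (h _), min_self]
  split_ifs
  · ring
  · ring

lemma IsBrownianSheet.isIndepIncrementProcess [IsProbabilityMeasure P]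
    (hW : IsBrownianSheet P d W) {s : ℝ} (hs : s ∈ Icc (0 : ℝ) 1) :
    IsIndepIncrementProcess P (sheetPath W s) where
  meas t := hW.1 _
  cont ω := (hW.2.1 ω).comp_continuous (by fun_prop) fun t => mem_unitSquare hs t
  zero ω := hW.2.2.1 ω _ (mem_unitSquare hs 0) (Or.inr (by simp))
  indep r t hr hrt := by
    let X : Fin d → Ω → ℝ := fun i ω => sheetPath W s t ω i - sheetPath W s r ω i
    let Y : Ici t × Fin d → Ω → ℝ := fun x ω =>
      sheetPath W s x.1 ω x.2 - sheetPath W s t ω x.2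
    have hm : ∀ q i, Measurable fun ω => sheetPath W s q ω i := fun q i => hW.measurable_apply _ i
    have hXY : IsGaussianProcess (Sum.elim X Y) P := by
      let φ : Fin d ⊕ (Ici t × Fin d) → ℝ × ℝ × Fin d :=
        Sum.elim (fun i => (t, r, i)) (fun x => ((x.1 : ℝ), t, x.2))
      have heq : Sum.elim X Y = (fun (x : ℝ × ℝ × Fin d) ω =>
          sheetPath W s x.1 ω x.2.2 - sheetPath W s x.2.1 ω x.2.2) ∘ φ := funext fun x => by
        cases x with
        | inl i => exact rfl
        | inr x => exact rfl
      rw [heq]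
      exact (hW.isGaussianProcess_increment hs).comp_right φ
    have hcov : ∀ i x, cov[X i, Y x; P] = 0 := fun i x => by
      have h1 : projIcc (0 : ℝ) 1 zero_le_one r ≤ projIcc (0 : ℝ) 1 zero_le_one t :=
        monotone_projIcc _ hrt
      have h2 : projIcc (0 : ℝ) 1 zero_le_one t ≤ projIcc (0 : ℝ) 1 zero_le_one x.1 :=
        monotone_projIcc _ (mem_Ici.1 x.1.2)
      have h1' := Subtype.coe_le_coe.2 h1
      have h2' := Subtype.coe_le_coe.2 h2
      simp only [X, Y]
      rw [hW.covariance_increment hs, min_eq_left h2', min_self, min_eq_left (h1'.trans h2'),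
        min_eq_left h1']
      simp
    have hind := hXY.indepFun_of_covariance_eq_zero
      (fun i => ((hm t i).sub (hm r i)).aemeasurable)
      (fun x => ((hm x.1 x.2).sub (hm t x.2)).aemeasurable) hcov
    have hφ : Measurable fun x : Fin d → ℝ => WithLp.toLp 2 x :=
      (PiLp.continuous_toLp 2 _).measurable
    have hψ : Measurable fun (y : Ici t × Fin d → ℝ) (q : Ici t) =>
        WithLp.toLp 2 fun i => y (q, i) :=
      measurable_pi_lambda _ fun q => hφ.comp <| measurable_pi_lambda _ fun i =>
        measurable_pi_apply _
    exact hind.comp hφ hψ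

lemma IsBrownianSheet.hasGaussianLaw_increment (hW : IsBrownianSheet P d W) {s : ℝ}
    (hs : s ∈ Icc (0 : ℝ) 1) (r t : ℝ) :
    HasGaussianLaw (fun ω i => (sheetPath W s t ω - sheetPath W s r ω) i) P := by
  have h := (hW.isGaussianProcess_increment hs).comp_right fun i : Fin d => (t, r, i)
  have h2 := (h.hasGaussianLaw Finset.univ).map
    (ContinuousLinearMap.pi fun i : Fin d =>
      ContinuousLinearMap.proj (R := ℝ) (φ := fun _ : (Finset.univ : Finset (Fin d)) => ℝ)
        ⟨i, Finset.mem_univ i⟩)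
  exact h2

lemma IsBrownianSheet.covariance_increment_self [IsProbabilityMeasure P]
    (hW : IsBrownianSheet P d W) {s : ℝ} (hs : s ∈ Icc (0 : ℝ) 1) {r t : ℝ} (hr : 0 ≤ r)
    (hrt : r ≤ t) (ht : t ≤ 1) (i j : Fin d) :
    cov[fun ω => (sheetPath W s t ω - sheetPath W s r ω) i,
      fun ω => (sheetPath W s t ω - sheetPath W s r ω) j; P] =
      if i = j then s * (t - r) else 0 := by
  have h := hW.covariance_increment hs (r := r) (t := t) (r' := r) (t' := t) i j
  rw [projIcc_of_mem _ ⟨hr, hrt.trans ht⟩, projIcc_of_mem _ ⟨hr.trans hrt, ht⟩] at h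
  simp only [min_self, min_eq_left hrt, min_eq_right hrt] at h
  refine h.trans ?_
  congr 1
  ring

end Sheet

section WeightedJensen

lemma ofReal_integral_le_lintegral {α : Type*} [MeasurableSpace α] {μ : Measure α} (f : α → ℝ) :
    ENNReal.ofReal (∫ x, f x ∂μ) ≤ ∫⁻ x, ENNReal.ofReal (f x) ∂μ := by
  by_cases hf : Integrable f μ
  · rw [integral_eq_lintegral_pos_part_sub_lintegral_neg_part hf]
    exact (ENNReal.ofReal_le_ofReal (sub_le_self _ ENNReal.toReal_nonneg)).trans
      ENNReal.ofReal_toReal_le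
  · simp [integral_undef hf]

lemma integrableOn_inv_sqrt (a b : ℝ) (ha : 0 ≤ a) : IntegrableOn (fun s => 1 / √s) (Ioc a b) := by
  rcases le_or_gt a b with hab | hab
  · have h := (intervalIntegral.intervalIntegrable_rpow' (a := a) (b := b)
      (r := -(1 / 2)) (by norm_num)).1
    refine h.congr_fun (fun s hs => ?_) measurableSet_Ioc
    simp [Real.rpow_neg (ha.trans hs.1.le), Real.sqrt_eq_rpow]
  · simp [Ioc_eq_empty hab.not_gt]

lemma setIntegral_inv_sqrt_eq {a h : ℝ} (ha : 0 ≤ a) (hh : 0 ≤ h) :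
    ∫ s in Ioc a (a + h), 1 / √s = 2 * (√(a + h) - √a) := by
  have h1 := integral_rpow (a := a) (b := a + h) (r := -(1 / 2)) (Or.inl (by norm_num))
  rw [intervalIntegral.integral_of_le (by linarith)] at h1
  rw [setIntegral_congr_fun (g := fun s => s ^ (-(1 / 2) : ℝ)) measurableSet_Ioc, h1,
    Real.sqrt_eq_rpow, Real.sqrt_eq_rpow]
  · norm_num
    ring
  · intro s hs
    simp [Real.rpow_neg (ha.trans hs.1.le), Real.sqrt_eq_rpow]

/-- Jensen's inequality for the exponential and the weight `1 / √s`. -/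
lemma exp_setIntegral_le_weighted {f : ℝ → ℝ} (hf : Measurable f) {M : ℝ}
    (hfM : ∀ s, f s ∈ Icc 0 M) {a h ν : ℝ} (ha : 0 ≤ a) (hh : 0 < h) (hah : a + h ≤ 1)
    (hν : 0 ≤ ν) :
    Real.exp (ν / (2 * √h) * ∫ s in Ioc a (a + h), f s) ≤
      ∫ s in Ioc a (a + h), (1 / (2 * (√(a + h) - √a))) * (1 / √s * Real.exp (ν * √s * f s)) := by
  set c := 2 * (√(a + h) - √a) with hc
  have hc0 : 0 < c := by
    have := Real.sqrt_lt_sqrt ha (by linarith : a < a + h)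
    rw [hc]; linarith
  have hch : c ≤ 2 * √h := by
    have : √(a + h) ≤ √a + √h := by
      rw [Real.sqrt_le_left (by positivity)]
      nlinarith [Real.sq_sqrt ha, Real.sq_sqrt hh.le,
        mul_nonneg (Real.sqrt_nonneg a) (Real.sqrt_nonneg h)]
    rw [hc]; linarith
  set A := ∫ s in Ioc a (a + h), f s with hA
  have hA0 : 0 ≤ A := setIntegral_nonneg measurableSet_Ioc fun s _ => (hfM s).1
  set α := ν / c * A with hα
  have hw := integrableOn_inv_sqrt a (a + h) ha
  have hfi : IntegrableOn f (Ioc a (a + h)) := (intervalIntegrable_of_mem_Icc hf hfM _ _).1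
  have h1 : Real.exp (ν / (2 * √h) * A) ≤ Real.exp α := by
    rw [hα]
    gcongr
  refine h1.trans ?_
  have hint : IntegrableOn (fun s => Real.exp α / c * ((1 - α) * (1 / √s) + ν * f s))
      (Ioc a (a + h)) := ((hw.const_mul _).add (hfi.const_mul _)).const_mul _
  have hval : ∫ s in Ioc a (a + h), Real.exp α / c * ((1 - α) * (1 / √s) + ν * f s) =
      Real.exp α := by
    rw [integral_const_mul, integral_add (hw.const_mul _) (hfi.const_mul _), integral_const_mul,
      integral_const_mul, setIntegral_inv_sqrt_eq ha hh.le, ← hc, ← hA]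
    have : ν * A = α * c := by rw [hα]; field_simp
    rw [this]
    field_simp
    ring
  rw [← hval]
  have hint2 : IntegrableOn (fun s => 1 / c * (1 / √s * Real.exp (ν * √s * f s)))
      (Ioc a (a + h)) := by
    refine Integrable.const_mul ?_ _
    refine Integrable.mono' (hw.mul_const (Real.exp (ν * M))) ?_ ?_
    · exact (by fun_prop : Measurable fun s => 1 / √s * Real.exp (ν * √s * f s)).aestronglyMeasurable
    · refine (ae_restrict_iff' measurableSet_Ioc).2 (Eventually.of_forall fun s hs => ?_)
      rw [Real.norm_eq_abs, abs_of_nonneg (by positivity)]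
      have : √s ≤ 1 := Real.sqrt_le_one.2 (hs.2.trans hah)
      have h2 : √s * f s ≤ M := by
        nlinarith [(hfM s).1, (hfM s).2, Real.sqrt_nonneg s]
      rw [mul_assoc]
      gcongr
  refine setIntegral_mono_on hint hint2 measurableSet_Ioc fun s hs => ?_
  have hs0 : 0 < √s := Real.sqrt_pos.2 (ha.trans_lt hs.1)
  have key := Real.add_one_le_exp (ν * √s * f s - α)
  rw [Real.exp_sub, le_div_iff₀ (Real.exp_pos _)] at key
  calc Real.exp α / c * ((1 - α) * (1 / √s) + ν * f s)
      = 1 / c * (1 / √s * ((ν * √s * f s - α + 1) * Real.exp α)) := by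
        field_simp
        ring
    _ ≤ _ := by gcongr

/-- Averaging exponential moment bounds over `s` against the weight `1 / √s`. -/
lemma lintegral_exp_setIntegral_le {Ω : Type*} [MeasurableSpace Ω] {P : Measure Ω} [SFinite P]
    {F : ℝ × Ω → ℝ} (hF : Measurable F) {M : ℝ} (hFM : ∀ z, F z ∈ Icc 0 M) {a h ν : ℝ} (ha : 0 ≤ a)
    (hh : 0 < h) (hah : a + h ≤ 1) (hν : 0 ≤ ν) {B : ℝ≥0∞}
    (hB : ∀ᵐ s, s ∈ Ioc a (a + h) →
      ∫⁻ ω, ENNReal.ofReal (Real.exp (ν * √s * F (s, ω))) ∂P ≤ B) :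
    ∫⁻ ω, ENNReal.ofReal (Real.exp (ν / (2 * √h) * ∫ s in Ioc a (a + h), F (s, ω))) ∂P ≤ B := by
  set c := 2 * (√(a + h) - √a) with hc
  have hc0 : 0 < c := by
    have := Real.sqrt_lt_sqrt ha (by linarith : a < a + h)
    rw [hc]; linarith
  have hw := integrableOn_inv_sqrt a (a + h) ha
  calc ∫⁻ ω, ENNReal.ofReal (Real.exp (ν / (2 * √h) * ∫ s in Ioc a (a + h), F (s, ω))) ∂P
      ≤ ∫⁻ ω, (∫⁻ s in Ioc a (a + h), ENNReal.ofReal (1 / c * (1 / √s)) *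
          ENNReal.ofReal (Real.exp (ν * √s * F (s, ω)))) ∂P := by
        refine lintegral_mono fun ω => ?_
        refine (ENNReal.ofReal_le_ofReal (exp_setIntegral_le_weighted (f := fun s => F (s, ω))
          (hF.comp (measurable_id.prodMk measurable_const)) (fun s => hFM _) ha hh hah hν)).trans ?_
        refine (ofReal_integral_le_lintegral _).trans ?_
        refine lintegral_mono fun s => ?_
        rw [← ENNReal.ofReal_mul (by positivity), mul_assoc (1 / c)]
    _ = ∫⁻ s in Ioc a (a + h), (∫⁻ ω, ENNReal.ofReal (1 / c * (1 / √s)) *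
          ENNReal.ofReal (Real.exp (ν * √s * F (s, ω))) ∂P) := by
        refine lintegral_lintegral_swap ?_
        have : Measurable fun z : Ω × ℝ => F (z.2, z.1) := hF.comp measurable_swap
        exact (by fun_prop : Measurable fun z : Ω × ℝ => ENNReal.ofReal (1 / c * (1 / √z.2)) *
          ENNReal.ofReal (Real.exp (ν * √z.2 * F (z.2, z.1)))).aemeasurable
    _ ≤ ∫⁻ s in Ioc a (a + h), ENNReal.ofReal (1 / c * (1 / √s)) * B := by
        refine setLIntegral_mono_ae' measurableSet_Ioc ?_
        filter_upwards [hB] with s hs hsm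
        rw [lintegral_const_mul' _ _ ENNReal.ofReal_ne_top]
        gcongr
        exact hs hsm
    _ = B := by
        rw [lintegral_mul_const _ (by fun_prop),
          ← ofReal_integral_eq_lintegral_ofReal (hw.const_mul _)
            (Eventually.of_forall fun s => by beta_reduce; positivity), integral_const_mul,
          setIntegral_inv_sqrt_eq ha hh.le, ← hc, one_div_mul_cancel hc0.ne', ENNReal.ofReal_one,
          one_mul]

end WeightedJensen

section SheetFunctional

variable {Ω : Type*} [MeasurableSpace Ω] {P : Measure Ω} {d : ℕ}
  {W : ℝ × ℝ → Ω → EuclideanSpace ℝ (Fin d)}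

/-- The integral of `g` along the sheet over the square with corner `(s₀, t₀)` and side `h`. -/
def sheetFunctional (W : ℝ × ℝ → Ω → EuclideanSpace ℝ (Fin d))
    (g : (ℝ × ℝ) × EuclideanSpace ℝ (Fin d) → ℝ) (s₀ t₀ h : ℝ) (ω : Ω) : ℝ :=
  ∫ s in Ioc s₀ (s₀ + h), ∫ t in Ioc t₀ (t₀ + h),
    g ((s, t), sheetPath W (projIcc 0 1 zero_le_one s) t ω)

lemma IsBrownianSheet.measurable_sheetPath (hW : IsBrownianSheet P d W) :
    Measurable fun z : (ℝ × ℝ) × Ω => sheetPath W (projIcc 0 1 zero_le_one z.1.1) z.1.2 z.2 := by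
  have h : Measurable fun z : Ω × (ℝ × ℝ) =>
      sheetPath W (projIcc 0 1 zero_le_one z.2.1) z.2.2 z.1 := by
    refine (stronglyMeasurable_uncurry_of_continuous_of_stronglyMeasurable
      (u := fun (p : ℝ × ℝ) ω => sheetPath W (projIcc 0 1 zero_le_one p.1) p.2 ω)
      (fun ω => ?_) fun p => (hW.1 _).stronglyMeasurable).measurable.comp measurable_swap
    exact (hW.2.1 ω).comp_continuous (by fun_prop) fun p => mem_unitSquare (Subtype.prop _) p.2
  exact h.comp measurable_swap

lemma measurable_inner_sheetFunctional (hW : IsBrownianSheet P d W)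
    {g : (ℝ × ℝ) × EuclideanSpace ℝ (Fin d) → ℝ} (hg : Measurable g) (t₀ h : ℝ) :
    Measurable fun z : ℝ × Ω => ∫ t in Ioc t₀ (t₀ + h),
      g ((z.1, t), sheetPath W (projIcc 0 1 zero_le_one z.1) t z.2) := by
  have h1 : Measurable fun z : (ℝ × Ω) × ℝ =>
      g ((z.1.1, z.2), sheetPath W (projIcc 0 1 zero_le_one z.1.1) z.2 z.1.2) :=
    hg.comp (((measurable_fst.comp measurable_fst).prodMk measurable_snd).prodMk
      (hW.measurable_sheetPath.comp
        (((measurable_fst.comp measurable_fst).prodMk measurable_snd).prodMk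
          (measurable_snd.comp measurable_fst))))
  exact h1.stronglyMeasurable.integral_prod_right'.measurable

lemma measurable_sheetFunctional (hW : IsBrownianSheet P d W)
    {g : (ℝ × ℝ) × EuclideanSpace ℝ (Fin d) → ℝ} (hg : Measurable g) (s₀ t₀ h : ℝ) :
    Measurable (sheetFunctional W g s₀ t₀ h) :=
  ((measurable_inner_sheetFunctional hW hg t₀ h).comp
    measurable_swap).stronglyMeasurable.integral_prod_right'.measurable

/-- Exponential moments of the integral along the sheet of the oscillation of a bounded monotone
function. -/
lemma IsBrownianSheet.lintegral_exp_sheetFunctional_le [IsProbabilityMeasure P]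
    (hW : IsBrownianSheet P d W) (hd : 0 < d)
    {g : (ℝ × ℝ) × EuclideanSpace ℝ (Fin d) → ℝ} (hg : Measurable g) {K : ℝ} (hK : 0 < K)
    (hgK : ∀ z, g z ∈ Icc 0 (2 * K)) {H : ℝ × ℝ → EuclideanSpace ℝ (Fin d) → ℝ}
    (hHK : ∀ p y, |H p y| ≤ K) (hHmono : ∀ p y z, (∀ j, y j ≤ z j) → H p y ≤ H p z)
    {x : ℝ} (hx : 0 < x)
    (hgH : ∀ᵐ z : (ℝ × ℝ) × EuclideanSpace ℝ (Fin d),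
      g z ≤ H z.1 (z.2 + diagVec d x) - H z.1 (z.2 - diagVec d x))
    {s₀ t₀ h l : ℝ} (hs₀ : 0 ≤ s₀) (ht₀ : 0 ≤ t₀) (hh : 0 < h) (hsh : s₀ + h ≤ 1)
    (hth : t₀ + h ≤ 1) (hl : 0 < l) :
    ∫⁻ ω, ENNReal.ofReal (Real.exp (l / (2 * x * h) * sheetFunctional W g s₀ t₀ h ω)) ∂P ≤
      2 * ENNReal.ofReal (Real.exp (4 * Real.pi * (l * (4 * K * √d)) ^ 2)) := by
  have hd' : 0 < √(d : ℝ) := Real.sqrt_pos.2 (by exact_mod_cast hd)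
  have hh' : 0 < √h := Real.sqrt_pos.2 hh
  have hae : ∀ᵐ s : ℝ, ∀ᵐ t : ℝ, ∀ᵐ y : EuclideanSpace ℝ (Fin d),
      g ((s, t), y) ≤ H (s, t) (y + diagVec d x) - H (s, t) (y - diagVec d x) := by
    have h1 := Measure.ae_ae_of_ae_prod (μ := (volume : Measure (ℝ × ℝ))) hgH
    exact Measure.ae_ae_of_ae_prod (μ := (volume : Measure ℝ)) h1
  have key := lintegral_exp_setIntegral_le (P := P)
    (measurable_inner_sheetFunctional hW hg t₀ h) (M := 2 * K * h) (fun z => ?_) hs₀ hh hsh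
    (ν := l / (x * √h)) (by positivity)
    (B := 2 * ENNReal.ofReal (Real.exp (4 * Real.pi * (l * (4 * K * √d)) ^ 2))) ?_
  · refine le_trans (le_of_eq ?_) key
    refine lintegral_congr fun ω => ?_
    congr 3
    have : √h * √h = h := Real.mul_self_sqrt hh.le
    field_simp
    linear_combination this
  · refine ⟨setIntegral_nonneg measurableSet_Ioc fun t _ => (hgK _).1, ?_⟩
    refine (le_abs_self _).trans ?_
    have := norm_setIntegral_le_of_norm_le_const (μ := volume) (s := Ioc t₀ (t₀ + h))
      (f := fun t => g ((z.1, t), sheetPath W (projIcc 0 1 zero_le_one z.1) t z.2)) (C := 2 * K)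
      (by simp) (fun t _ => by rw [Real.norm_eq_abs, abs_of_nonneg (hgK _).1]; exact (hgK _).2)
    simpa [hh.le] using this
  · filter_upwards [hae] with s hs hsm
    have hs0 : 0 < s := hs₀.trans_lt hsm.1
    have hsI : s ∈ Icc (0 : ℝ) 1 := ⟨hs0.le, hsm.2.trans hsh⟩
    have hs' : 0 < √s := Real.sqrt_pos.2 hs0
    have hproj : (projIcc (0 : ℝ) 1 zero_le_one s : ℝ) = s := by rw [projIcc_of_mem _ hsI]
    have := lintegral_exp_functional_le_two_mul (hW.isIndepIncrementProcess hsI)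
      (g := fun z : ℝ × EuclideanSpace ℝ (Fin d) => g ((s, z.1), z.2)) (K := 2 * K)
      (T := t₀ + h) (μ := l / (x * √h) * √s)
      (hg.comp (((measurable_const (a := s)).prodMk measurable_fst).prodMk measurable_snd))
      (fun z => hgK _) (by positivity) (a := 4 * K * √d * x / √s) (by positivity) ?_ ht₀
      (by linarith)
    · simp only [hproj]
      have hμ : l / (x * √h) * √s * (4 * K * √d * x / √s) = l * (4 * K * √d) / √h := by field_simp
      rw [hμ, div_pow, Real.sq_sqrt hh.le, add_sub_cancel_left, mul_assoc (4 * Real.pi),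
        div_mul_cancel₀ _ hh.ne'] at this
      exact this
    · filter_upwards [hs] with t ht r hr hrt htT w
      have hv : 0 < s * (t - r) := mul_pos hs0 (sub_pos.2 hrt)
      have h1 := lintegral_gaussian_le_of_diagonal_increment hd
        (Y := fun ω => sheetPath W s t ω - sheetPath W s r ω)
        ((hW.1 _).sub (hW.1 _)) (hW.hasGaussianLaw_increment hsI r t) hv
        (hW.covariance_increment_self hsI hr hrt.le (htT.trans hth))
        (g := fun y => g ((s, t), y)) (hg.comp measurable_prodMk_left) (hHK (s, t))
        (hHmono (s, t)) hx.le ht w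
      refine h1.trans (le_of_eq ?_)
      rw [Real.sqrt_mul hs0.le, div_div]

end SheetFunctional

/-- A union bound: exponential moments of finitely many variables on each level give an almost sure
bound growing like the square root of the level. -/
lemma exists_measurable_sqrt_bound {Ω : Type*} [MeasurableSpace Ω] {P : Measure Ω} {κ : ℕ → Type*}
    [∀ n, Fintype (κ n)] {D : ℕ} (hcard : ∀ n, Fintype.card (κ n) ≤ D * 16 ^ (n + 1))
    {Z : ∀ n, κ n → Ω → ℝ} (hZ : ∀ n j, Measurable (Z n j)) {c : ℝ} (hc : 0 ≤ c)
    (hexp : ∀ (n : ℕ) (j : κ n), ∫⁻ ω, ENNReal.ofReal (Real.exp (√((n : ℝ) + 1) * Z n j ω)) ∂P ≤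
      2 * ENNReal.ofReal (Real.exp (c * (n + 1)))) :
    ∃ C : Ω → ℝ, Measurable C ∧ (∀ ω, 0 ≤ C ω) ∧
      ∀ᵐ ω ∂P, ∀ (n : ℕ) (j : κ n), Z n j ω ≤ C ω * √((n : ℝ) + 1) := by
  set c' := c + Real.log 32 with hc'
  have hlog : 0 ≤ Real.log 32 := Real.log_nonneg (by norm_num)
  let T : Ω → ℝ≥0∞ := fun ω => ∑' n, ∑ j : κ n,
    ENNReal.ofReal (Real.exp (-(c' * (n + 1)))) *
      ENNReal.ofReal (Real.exp (√((n : ℝ) + 1) * Z n j ω))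
  have hterm : ∀ (n : ℕ) (j : κ n), Measurable fun ω => ENNReal.ofReal (Real.exp (-(c' * ((n : ℝ) + 1)))) *
      ENNReal.ofReal (Real.exp (√((n : ℝ) + 1) * Z n j ω)) := fun n j => by
    have := hZ n j
    fun_prop
  have hT : Measurable T := Measurable.tsum fun n =>
    Finset.measurable_sum _ fun j _ => hterm n j
  have hTint : ∫⁻ ω, T ω ∂P ≠ ∞ := by
    have hbound : ∀ n : ℕ, ∫⁻ ω, ∑ j : κ n, ENNReal.ofReal (Real.exp (-(c' * (n + 1)))) *
        ENNReal.ofReal (Real.exp (√((n : ℝ) + 1) * Z n j ω)) ∂P ≤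
        ENNReal.ofReal (2 * D * (1 / 2) ^ (n + 1)) := fun n => by
      rw [lintegral_finsetSum _ fun j _ => hterm n j]
      have hj : ∀ j : κ n, ∫⁻ ω, ENNReal.ofReal (Real.exp (-(c' * (n + 1)))) *
          ENNReal.ofReal (Real.exp (√((n : ℝ) + 1) * Z n j ω)) ∂P ≤
          ENNReal.ofReal (2 * (1 / 32) ^ (n + 1)) := fun j => by
        rw [lintegral_const_mul' _ _ ENNReal.ofReal_ne_top]
        refine (mul_le_mul_right (hexp n j) _).trans (le_of_eq ?_)
        rw [mul_left_comm, ← ENNReal.ofReal_mul (Real.exp_pos _).le, ← Real.exp_add,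
          ENNReal.ofReal_mul zero_le_two, ENNReal.ofReal_ofNat]
        congr 2
        rw [show -(c' * ((n : ℝ) + 1)) + c * (n + 1) = ((n + 1 : ℕ) : ℝ) * (-Real.log 32) by
          rw [hc']; push_cast; ring, Real.exp_nat_mul, Real.exp_neg,
          Real.exp_log (by norm_num), one_div]
      refine (Finset.sum_le_sum fun j _ => hj j).trans ?_
      rw [Finset.sum_const, Finset.card_univ, nsmul_eq_mul, ← ENNReal.ofReal_natCast,
        ← ENNReal.ofReal_mul (Nat.cast_nonneg _)]
      refine ENNReal.ofReal_le_ofReal ?_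
      have h1 : (Fintype.card (κ n) : ℝ) ≤ D * 16 ^ (n + 1) := by exact_mod_cast hcard n
      calc (Fintype.card (κ n) : ℝ) * (2 * (1 / 32) ^ (n + 1))
          ≤ D * 16 ^ (n + 1) * (2 * (1 / 32) ^ (n + 1)) := by gcongr
        _ = 2 * D * (16 * (1 / 32)) ^ (n + 1) := by rw [mul_pow]; ring
        _ = 2 * D * (1 / 2) ^ (n + 1) := by norm_num
    have hs : Summable fun n : ℕ => 2 * (D : ℝ) * (1 / 2) ^ (n + 1) :=
      ((summable_nat_add_iff 1).2 summable_geometric_two).mul_left _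
    rw [lintegral_tsum fun n => (Finset.measurable_sum _ fun j _ => hterm n j).aemeasurable]
    refine ne_top_of_le_ne_top ?_ (ENNReal.tsum_le_tsum hbound)
    rw [← ENNReal.ofReal_tsum_of_nonneg (fun n => by positivity) hs]
    exact ENNReal.ofReal_ne_top
  refine ⟨fun ω => c' + Real.log (1 + (T ω).toReal), ?_, fun ω => ?_, ?_⟩
  · exact measurable_const.add (Real.measurable_log.comp (measurable_const.add hT.ennreal_toReal))
  · have : 0 ≤ Real.log (1 + (T ω).toReal) := Real.log_nonneg (by simp)
    positivity
  filter_upwards [ae_lt_top hT hTint] with ω hω n j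
  have h1 : ENNReal.ofReal (Real.exp (-(c' * (n + 1)))) *
      ENNReal.ofReal (Real.exp (√((n : ℝ) + 1) * Z n j ω)) ≤ T ω :=
    (Finset.single_le_sum (f := fun j => ENNReal.ofReal (Real.exp (-(c' * ((n : ℝ) + 1)))) *
      ENNReal.ofReal (Real.exp (√((n : ℝ) + 1) * Z n j ω))) (fun _ _ => zero_le)
      (Finset.mem_univ j)).trans (ENNReal.le_tsum (f := fun n : ℕ => ∑ j : κ n,
        ENNReal.ofReal (Real.exp (-(c' * ((n : ℝ) + 1)))) *
          ENNReal.ofReal (Real.exp (√((n : ℝ) + 1) * Z n j ω))) n)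
  rw [← ENNReal.ofReal_mul (Real.exp_pos _).le, ← Real.exp_add,
    ENNReal.ofReal_le_iff_le_toReal hω.ne] at h1
  have h2 : -(c' * ((n : ℝ) + 1)) + √((n : ℝ) + 1) * Z n j ω ≤ Real.log (1 + (T ω).toReal) := by
    rw [Real.le_log_iff_exp_le (by positivity)]
    linarith
  have hL : 0 ≤ Real.log (1 + (T ω).toReal) := Real.log_nonneg (by simp)
  have hs : 1 ≤ √((n : ℝ) + 1) := Real.one_le_sqrt.2 (by linarith [Nat.cast_nonneg (α := ℝ) n])
  have hss : √((n : ℝ) + 1) * √((n : ℝ) + 1) = n + 1 := Real.mul_self_sqrt (by positivity)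
  refine le_of_mul_le_mul_left ?_ (zero_lt_one.trans_le hs)
  have : Real.log (1 + (T ω).toReal) ≤ Real.log (1 + (T ω).toReal) * ((n : ℝ) + 1) :=
    le_mul_of_one_le_right hL (by linarith [Nat.cast_nonneg (α := ℝ) n])
  calc √((n : ℝ) + 1) * Z n j ω ≤ (c' + Real.log (1 + (T ω).toReal)) * (n + 1) := by linarith
    _ = _ := by linear_combination (-(c' + Real.log (1 + (T ω).toReal))) * hss

/-- Almost surely, the oscillation functionals over all dyadic squares of side `2⁻ⁿ` and all scales
`2⁻ʳ` with `r < 4ⁿ` are at most of order `√n 2⁻ⁿ 2⁻ʳ`. -/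
lemma IsBrownianSheet.exists_sheetFunctional_bound {Ω : Type*} [MeasurableSpace Ω] {P : Measure Ω}
    [IsProbabilityMeasure P] {d : ℕ} {W : ℝ × ℝ → Ω → EuclideanSpace ℝ (Fin d)}
    (hW : IsBrownianSheet P d W) {g : Fin d → ℕ → (ℝ × ℝ) × EuclideanSpace ℝ (Fin d) → ℝ}
    (hg : ∀ i r, Measurable (g i r)) {K : ℝ} (hK : 0 < K)
    (hgK : ∀ i r z, g i r z ∈ Icc 0 (2 * K))
    {H : Fin d → ℝ × ℝ → EuclideanSpace ℝ (Fin d) → ℝ} (hHK : ∀ i p y, |H i p y| ≤ K)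
    (hHmono : ∀ i p y z, (∀ j, y j ≤ z j) → H i p y ≤ H i p z)
    (hgH : ∀ i (r : ℕ), ∀ᵐ z : (ℝ × ℝ) × EuclideanSpace ℝ (Fin d),
      g i r z ≤ H i z.1 (z.2 + diagVec d ((2 : ℝ) ^ r)⁻¹) - H i z.1 (z.2 - diagVec d ((2 : ℝ) ^ r)⁻¹)) :
    ∃ C : Ω → ℝ, Measurable C ∧ (∀ ω, 0 ≤ C ω) ∧ ∀ᵐ ω ∂P, ∀ n : ℕ, 0 < n → ∀ k k' r : ℕ, k < 2 ^ n →
      k' < 2 ^ n → r < 4 ^ n → ∀ i,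
        sheetFunctional W (g i r) (k * ((2 : ℝ) ^ n)⁻¹) (k' * ((2 : ℝ) ^ n)⁻¹) ((2 : ℝ) ^ n)⁻¹ ω ≤
          C ω * √n * (2 * ((2 : ℝ) ^ r)⁻¹ * ((2 : ℝ) ^ n)⁻¹) := by
  let κ : ℕ → Type := fun n => Fin (2 ^ (n + 1)) × Fin (2 ^ (n + 1)) × Fin (4 ^ (n + 1)) × Fin d
  let A : ∀ n, κ n → Ω → ℝ := fun n j => sheetFunctional W (g j.2.2.2 j.2.2.1)
    ((j.1 : ℕ) * ((2 : ℝ) ^ (n + 1))⁻¹) ((j.2.1 : ℕ) * ((2 : ℝ) ^ (n + 1))⁻¹) ((2 : ℝ) ^ (n + 1))⁻¹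
  let e : ∀ n, κ n → ℝ := fun n j =>
    2 * ((2 : ℝ) ^ (j.2.2.1 : ℕ))⁻¹ * ((2 : ℝ) ^ (n + 1))⁻¹
  have he : ∀ n j, 0 < e n j := fun n j => by positivity
  have hle : ∀ (n : ℕ) (k : Fin (2 ^ (n + 1))),
      (k : ℕ) * ((2 : ℝ) ^ (n + 1))⁻¹ + ((2 : ℝ) ^ (n + 1))⁻¹ ≤ 1 := fun n k => by
    have h1 : ((k : ℕ) : ℝ) + 1 ≤ 2 ^ (n + 1) := by exact_mod_cast k.2
    rw [← add_one_mul, ← div_eq_mul_inv]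
    exact div_le_one_of_le₀ h1 (by positivity)
  have hcard : ∀ n, Fintype.card (κ n) ≤ d * 16 ^ (n + 1) := fun n => by
    simp only [κ, Fintype.card_prod, Fintype.card_fin]
    refine le_of_eq ?_
    rw [show (16 : ℕ) = 2 * 2 * 4 by norm_num, mul_pow, mul_pow]
    ring
  have hexp : ∀ (n : ℕ) (j : κ n),
      ∫⁻ ω, ENNReal.ofReal (Real.exp (√((n : ℝ) + 1) * (A n j ω / e n j))) ∂P ≤
        2 * ENNReal.ofReal (Real.exp (4 * Real.pi * (4 * K * √d) ^ 2 * (n + 1))) := fun n j => by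
    have hd : 0 < d := j.2.2.2.pos
    have hx : (0 : ℝ) < ((2 : ℝ) ^ (j.2.2.1 : ℕ))⁻¹ := by positivity
    have h := hW.lintegral_exp_sheetFunctional_le hd (hg j.2.2.2 j.2.2.1) hK (hgK _ _)
      (hHK j.2.2.2) (hHmono j.2.2.2) hx (hgH _ _)
      (s₀ := (j.1 : ℕ) * ((2 : ℝ) ^ (n + 1))⁻¹) (t₀ := (j.2.1 : ℕ) * ((2 : ℝ) ^ (n + 1))⁻¹)
      (h := ((2 : ℝ) ^ (n + 1))⁻¹) (l := √((n : ℝ) + 1)) (by positivity) (by positivity)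
      (by positivity) (hle n j.1) (hle n j.2.1) (by positivity)
    rw [mul_pow, Real.sq_sqrt (by positivity)] at h
    refine le_trans (le_of_eq ?_) (h.trans (le_of_eq ?_))
    · refine lintegral_congr fun ω => ?_
      rw [mul_div_assoc', div_mul_eq_mul_div]
    · congr 3
      ring
  obtain ⟨C, hCm, hC0, hC⟩ := exists_measurable_sqrt_bound
    (fun n => hcard n)
    (fun n j => (measurable_sheetFunctional hW (hg _ _) _ _ _).div_const _) (by positivity) hexp
  refine ⟨C, hCm, hC0, ?_⟩
  filter_upwards [hC] with ω hω n hn k k' r hk hk' hr i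
  obtain ⟨m, rfl⟩ : ∃ m, n = m + 1 := ⟨n - 1, by omega⟩
  have := hω m (⟨k, hk⟩, ⟨k', hk'⟩, ⟨r, hr⟩, i)
  rw [div_le_iff₀ (he _ _)] at this
  push_cast
  exact this

section DoubleIntegral

lemma integrableOn_of_abs_le {α : Type*} [MeasurableSpace α] {μ : Measure α} {f : α → ℝ}
    (hf : Measurable f) {M : ℝ} (hM : ∀ p, |f p| ≤ M) {s : Set α} (hs : μ s ≠ ∞) :
    IntegrableOn f s μ :=
  Measure.integrableOn_of_bounded (M := M) hs hf.aestronglyMeasurable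
    (Eventually.of_forall fun p => hM p)

lemma intervalIntegrable_of_abs_le {f : ℝ → ℝ} (hf : Measurable f) {M : ℝ} (hM : ∀ p, |f p| ≤ M)
    (a b : ℝ) : IntervalIntegrable f volume a b :=
  ⟨integrableOn_of_abs_le hf hM (by simp), integrableOn_of_abs_le hf hM (by simp)⟩

variable {f : ℝ × ℝ → ℝ} {M : ℝ}

lemma intervalIntegrable_inner (hf : Measurable f) (hM : ∀ p, |f p| ≤ M) (a b c e : ℝ) :
    IntervalIntegrable (fun t => ∫ s in a..b, f (s, t)) volume c e := by
  refine intervalIntegrable_of_abs_le (M := M * |b - a|) ?_ (fun t => ?_) c e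
  · have h : ∀ S : Set ℝ, Measurable fun t => ∫ s in S, f (s, t) := fun S =>
      ((hf.comp measurable_swap).stronglyMeasurable.integral_prod_right').measurable
    exact (h _).sub (h _)
  · exact intervalIntegral.norm_integral_le_of_norm_le_const (f := fun s => f (s, t)) (C := M)
      fun s _ => hM _

/-- A function with mixed boundary increments given by a double integral has rectangular increments
given by the double integral over the rectangle. -/
lemma rectangle_increment_eq (hf : Measurable f) (hM : ∀ p, |f p| ≤ M) {v : ℝ × ℝ → ℝ}
    (hv : ∀ p ∈ Icc (0 : ℝ × ℝ) 1, v p - v (p.1, 0) - v (0, p.2) + v (0, 0) =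
      ∫ t in (0 : ℝ)..p.2, ∫ s in (0 : ℝ)..p.1, f (s, t))
    {s₀ s t₀ t : ℝ} (hs₀ : s₀ ∈ Icc (0 : ℝ) 1) (hs : s ∈ Icc (0 : ℝ) 1) (ht₀ : t₀ ∈ Icc (0 : ℝ) 1)
    (ht : t ∈ Icc (0 : ℝ) 1) :
    v (s, t) - v (s, t₀) - v (s₀, t) + v (s₀, t₀) =
      ∫ t' in t₀..t, ∫ s' in s₀..s, f (s', t') := by
  have hmem : ∀ {a b : ℝ}, a ∈ Icc (0 : ℝ) 1 → b ∈ Icc (0 : ℝ) 1 → (a, b) ∈ Icc (0 : ℝ × ℝ) 1 :=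
    fun ha hb => ⟨⟨ha.1, hb.1⟩, ⟨ha.2, hb.2⟩⟩
  have h1 := hv _ (hmem hs ht)
  have h2 := hv _ (hmem hs ht₀)
  have h3 := hv _ (hmem hs₀ ht)
  have h4 := hv _ (hmem hs₀ ht₀)
  have hi := intervalIntegrable_inner hf hM
  have hslice : ∀ t' a b, IntervalIntegrable (fun s' => f (s', t')) volume a b := fun t' =>
    intervalIntegrable_of_abs_le (hf.comp measurable_prodMk_right) fun _ => hM _
  have h5 : ∫ t' in t₀..t, ∫ s' in s₀..s, f (s', t') =
      (∫ t' in t₀..t, ∫ s' in (0 : ℝ)..s, f (s', t')) -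
        ∫ t' in t₀..t, ∫ s' in (0 : ℝ)..s₀, f (s', t') := by
    rw [← intervalIntegral.integral_sub (hi _ _ _ _) (hi _ _ _ _)]
    refine intervalIntegral.integral_congr fun t' _ => ?_
    exact (intervalIntegral.integral_interval_sub_left (hslice _ _ _) (hslice _ _ _)).symm
  rw [h5, ← intervalIntegral.integral_interval_sub_left (hi 0 s 0 t) (hi 0 s 0 t₀),
    ← intervalIntegral.integral_interval_sub_left (hi 0 s₀ 0 t) (hi 0 s₀ 0 t₀)]
  linarith

lemma abs_double_integral_le (hf : Measurable f) (hM : ∀ p, |f p| ≤ M) {G : ℝ × ℝ → ℝ}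
    (hG : Measurable G) (hGM : ∀ p, G p ∈ Icc 0 M) {s₀ t₀ h s t : ℝ} (hs : s ∈ Ioc s₀ (s₀ + h))
    (ht : t ∈ Ioc t₀ (t₀ + h))
    (hfG : ∀ p ∈ Ioc s₀ (s₀ + h) ×ˢ Ioc t₀ (t₀ + h), |f p| ≤ G p) :
    |∫ t' in t₀..t, ∫ s' in s₀..s, f (s', t')| ≤
      ∫ s' in Ioc s₀ (s₀ + h), ∫ t' in Ioc t₀ (t₀ + h), G (s', t') := by
  have hfin : ∀ a b c e : ℝ, (volume : Measure (ℝ × ℝ)) (Ioc a b ×ˢ Ioc c e) ≠ ∞ :=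
    fun a b c e => by
      rw [Measure.volume_eq_prod, Measure.prod_prod]
      exact ENNReal.mul_ne_top (by simp) (by simp)
  have hGM' : ∀ p, |G p| ≤ M := fun p => by rw [abs_of_nonneg (hGM p).1]; exact (hGM p).2
  have hGi := integrableOn_of_abs_le hG hGM' (hfin s₀ (s₀ + h) t₀ (t₀ + h))
  have hfi := integrableOn_of_abs_le hf hM (hfin s₀ s t₀ t)
  have hsub : Ioc s₀ s ×ˢ Ioc t₀ t ⊆ Ioc s₀ (s₀ + h) ×ˢ Ioc t₀ (t₀ + h) :=
    prod_mono (Ioc_subset_Ioc_right hs.2) (Ioc_subset_Ioc_right ht.2)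
  have h1 : ∫ t' in t₀..t, ∫ s' in s₀..s, f (s', t') = ∫ p in Ioc s₀ s ×ˢ Ioc t₀ t, f p := by
    simp only [intervalIntegral.integral_of_le ht.1.le, intervalIntegral.integral_of_le hs.1.le]
    rw [Measure.volume_eq_prod, ← setIntegral_prod_swap,
      setIntegral_prod _ ((integrableOn_of_abs_le (f := fun z : ℝ × ℝ => f z.swap)
        (hf.comp measurable_swap) (fun p => hM _) (hfin t₀ t s₀ s)))]
    rfl
  rw [h1, ← setIntegral_prod (μ := volume) (ν := volume) G hGi]
  calc |∫ p in Ioc s₀ s ×ˢ Ioc t₀ t, f p| ≤ ∫ p in Ioc s₀ s ×ˢ Ioc t₀ t, |f p| :=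
        abs_integral_le_integral_abs
    _ ≤ ∫ p in Ioc s₀ s ×ˢ Ioc t₀ t, G p :=
        setIntegral_mono_on hfi.abs (hGi.mono_set hsub) (measurableSet_Ioc.prod measurableSet_Ioc)
          fun p hp => hfG p (hsub hp)
    _ ≤ ∫ p in Ioc s₀ (s₀ + h) ×ˢ Ioc t₀ (t₀ + h), G p :=
        setIntegral_mono_set hGi (Eventually.of_forall fun p => (hGM p).1) hsub.eventuallyLE

end DoubleIntegral

/-- A discrete Gronwall argument on the dyadic squares of side `2⁻ⁿ`. -/
lemma abs_le_of_dyadic_increment_le {ι : Type*} [Finite ι] {n : ℕ} {v : ι → ℝ × ℝ → ℝ}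
    (hcont : ∀ i, ContinuousOn (v i) (Icc (0 : ℝ × ℝ) 1)) {β θ : ℝ} (hβ : 0 ≤ β) (hθ : 0 ≤ θ)
    (hθ' : θ ≤ 1 / 6) (hbdry : ∀ i, ∀ r ∈ Icc (0 : ℝ) 1, |v i (r, 0)| ≤ β ∧ |v i (0, r)| ≤ β)
    {Q : ℕ → ℕ → Set (ℝ × ℝ)} (hQ : ∀ k l, Q k l =
      Ioc (k * ((2 : ℝ) ^ n)⁻¹) (k * ((2 : ℝ) ^ n)⁻¹ + ((2 : ℝ) ^ n)⁻¹) ×ˢ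
        Ioc (l * ((2 : ℝ) ^ n)⁻¹) (l * ((2 : ℝ) ^ n)⁻¹ + ((2 : ℝ) ^ n)⁻¹))
    (hstep : ∀ k l : ℕ, k < 2 ^ n → l < 2 ^ n → ∀ S, β ≤ S → (∀ i, ∀ p ∈ Q k l, |v i p| ≤ S) →
      ∀ i, ∀ p ∈ Q k l, |v i p - v i (p.1, l * ((2 : ℝ) ^ n)⁻¹) - v i (k * ((2 : ℝ) ^ n)⁻¹, p.2) +
        v i (k * ((2 : ℝ) ^ n)⁻¹, l * ((2 : ℝ) ^ n)⁻¹)| ≤ θ * S)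
    {k l : ℕ} (hk : k < 2 ^ n) (hl : l < 2 ^ n) (i : ι) {p : ℝ × ℝ} (hp : p ∈ Q k l) :
    |v i p| ≤ 3 ^ (k + l + 1) * (1 + 3 * θ) ^ (k + l + 2) * β := by
  induction hm : k + l using Nat.strong_induction_on generalizing k l i p with
  | _ m ih =>
  subst hm
  set h := ((2 : ℝ) ^ n)⁻¹ with hh
  have hh0 : 0 < h := by positivity
  have hle : ∀ {k : ℕ}, k < 2 ^ n → k * h + h ≤ 1 := fun {k} hk => by
    have h1 : (k : ℝ) + 1 ≤ 2 ^ n := by exact_mod_cast hk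
    rw [← add_one_mul, hh, ← div_eq_mul_inv]
    exact div_le_one_of_le₀ h1 (by positivity)
  have hunit : ∀ {k : ℕ}, k < 2 ^ n → ∀ {s}, s ∈ Ioc (k * h) (k * h + h) → s ∈ Icc (0 : ℝ) 1 :=
    fun {k} hk {s} hs =>
      ⟨(by positivity : (0 : ℝ) ≤ k * h).trans hs.1.le, hs.2.trans (hle hk)⟩
  have hpred : ∀ k : ℕ, ((k + 1 : ℕ) : ℝ) * h ∈ Ioc (k * h) (k * h + h) := fun k => by
    push_cast
    constructor <;> linarith
  set D := 3 ^ (k + l) * (1 + 3 * θ) ^ (k + l + 1) * β with hD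
  have h3 : (1 : ℝ) ≤ 1 + 3 * θ := by linarith
  have hβD : β ≤ D := le_mul_of_one_le_left hβ
    (one_le_mul_of_one_le_of_one_le (one_le_pow₀ (by norm_num)) (one_le_pow₀ h3))
  have hD0 : 0 ≤ D := hβ.trans hβD
  have hmono : ∀ m, m + 1 ≤ k + l → 3 ^ (m + 1) * (1 + 3 * θ) ^ (m + 2) * β ≤ D := fun m hm => by
    have h4 : (3 : ℝ) ^ (m + 1) ≤ 3 ^ (k + l) := pow_le_pow_right₀ (by norm_num) hm
    have h5 : (1 + 3 * θ) ^ (m + 2) ≤ (1 + 3 * θ) ^ (k + l + 1) :=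
      pow_le_pow_right₀ h3 (by omega)
    rw [hD]
    gcongr
  have hbelow : ∀ i, ∀ s ∈ Ioc (k * h) (k * h + h), |v i (s, l * h)| ≤ D := fun i s hs => by
    rcases l with _ | l
    · simpa using (hbdry i s (hunit hk hs)).1.trans hβD
    · exact (ih (k + l) (by omega) hk (by omega : l < 2 ^ n) i
        (by rw [hQ]; exact ⟨hs, hpred l⟩) rfl).trans (hmono _ (by omega))
  have hleft : ∀ i, ∀ t ∈ Ioc (l * h) (l * h + h), |v i (k * h, t)| ≤ D := fun i t ht => by
    rcases k with _ | k
    · simpa using (hbdry i t (hunit hl ht)).2.trans hβD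
    · exact (ih (k + l) (by omega) (by omega : k < 2 ^ n) hl i
        (by rw [hQ]; exact ⟨hpred k, ht⟩) rfl).trans (hmono _ (by omega))
  have hcorner : ∀ i, |v i (k * h, l * h)| ≤ D := fun i => by
    rcases k with _ | k
    · have : l * h ∈ Icc (0 : ℝ) 1 := ⟨by positivity, by linarith [hle hl]⟩
      simpa using (hbdry i _ this).2.trans hβD
    rcases l with _ | l
    · have : ((k + 1 : ℕ) : ℝ) * h ∈ Icc (0 : ℝ) 1 := ⟨by positivity, by linarith [hle hk]⟩
      simpa using (hbdry i _ this).1.trans hβD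
    · exact (ih (k + l) (by omega) (by omega : k < 2 ^ n) (by omega : l < 2 ^ n) i
        (by rw [hQ]; exact ⟨hpred k, hpred l⟩) rfl).trans (hmono _ (by omega))
  have hQunit : ∀ q ∈ Q k l, q ∈ Icc (0 : ℝ × ℝ) 1 := fun q hq => by
    rw [hQ] at hq
    exact ⟨⟨(hunit hk hq.1).1, (hunit hl hq.2).1⟩, ⟨(hunit hk hq.1).2, (hunit hl hq.2).2⟩⟩
  let B : Set ℝ := {x | ∃ j, ∃ q ∈ Q k l, x = |v j q|}
  have hB : BddAbove B := by
    choose M hM using fun j => isCompact_Icc.exists_bound_of_continuousOn (hcont j)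
    obtain ⟨M', hM'⟩ := (finite_range M).bddAbove
    refine ⟨M', ?_⟩
    rintro _ ⟨j, q, hq, rfl⟩
    exact (hM j q (hQunit q hq)).trans (hM' ⟨j, rfl⟩)
  have hBS : ∀ j, ∀ q ∈ Q k l, |v j q| ≤ sSup B := fun j q hq => le_csSup hB ⟨j, q, hq, rfl⟩
  have hS : sSup B ≤ 3 * D * (1 + 3 * θ) := by
    rcases le_total (sSup B) (3 * D) with hS | hS
    · exact hS.trans (le_mul_of_one_le_right (by positivity) h3)
    have h4 : sSup B ≤ 3 * D + θ * sSup B := by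
      refine csSup_le ⟨_, i, p, hp, rfl⟩ ?_
      rintro _ ⟨j, q, hq, rfl⟩
      have h5 := abs_le.1 (hstep k l hk hl (sSup B) (by linarith) hBS j q hq)
      rw [hQ] at hq
      have h6 := abs_le.1 (hbelow j q.1 hq.1)
      have h7 := abs_le.1 (hleft j q.2 hq.2)
      have h8 := abs_le.1 (hcorner j)
      exact abs_le.2 ⟨by linarith, by linarith⟩
    have h9 : 1 ≤ (1 - θ) * (1 + 3 * θ) := by nlinarith
    have h10 : (1 - θ) * sSup B ≤ 3 * D := by linarith
    have h11 : 0 ≤ sSup B := by linarith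
    calc sSup B ≤ (1 - θ) * (1 + 3 * θ) * sSup B := le_mul_of_one_le_left h11 h9
      _ = (1 - θ) * sSup B * (1 + 3 * θ) := by ring
      _ ≤ 3 * D * (1 + 3 * θ) := by gcongr
  calc |v i p| ≤ sSup B := hBS i p hp
    _ ≤ 3 * D * (1 + 3 * θ) := hS
    _ = 3 ^ (k + l + 1) * (1 + 3 * θ) ^ (k + l + 2) * β := by rw [hD]; ring

/-- The projection of the plane onto the unit square. -/
def clampSquare (p : ℝ × ℝ) : ℝ × ℝ :=
  (projIcc 0 1 zero_le_one p.1, projIcc 0 1 zero_le_one p.2)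

lemma continuous_clampSquare : Continuous clampSquare := by
  unfold clampSquare
  fun_prop

lemma clampSquare_mem (p : ℝ × ℝ) : clampSquare p ∈ Icc (0 : ℝ × ℝ) 1 :=
  mem_unitSquare (projIcc (0 : ℝ) 1 zero_le_one p.1).2 p.2

lemma clampSquare_of_mem {p : ℝ × ℝ} (hp : p ∈ Icc (0 : ℝ × ℝ) 1) : clampSquare p = p :=
  Prod.ext (by simp [clampSquare, projIcc_of_mem zero_le_one ⟨hp.1.1, hp.2.1⟩])
    (by simp [clampSquare, projIcc_of_mem zero_le_one ⟨hp.1.2, hp.2.2⟩])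

lemma sheetPath_projIcc {Ω : Type*} {d : ℕ} (W : ℝ × ℝ → Ω → EuclideanSpace ℝ (Fin d))
    (p : ℝ × ℝ) (ω : Ω) :
    sheetPath W (projIcc 0 1 zero_le_one p.1) p.2 ω = W (clampSquare p) ω := rfl

lemma intervalIntegral_apply {ι : Type*} [Fintype ι] {φ : ℝ → EuclideanSpace ℝ ι} {a b : ℝ}
    (hφ : ∀ j, IntervalIntegrable (fun x => φ x j) volume a b) (i : ι) :
    (∫ x in a..b, φ x) i = ∫ x in a..b, φ x i := by
  rw [intervalIntegral, PiLp.sub_apply, eval_integral_piLp fun j => (hφ j).1,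
    eval_integral_piLp fun j => (hφ j).2, intervalIntegral]

lemma abs_rectangle_increment_le {d : ℕ}
    {b : ℝ × ℝ → EuclideanSpace ℝ (Fin d) → EuclideanSpace ℝ (Fin d)}
    (hmeas : Measurable fun q : (ℝ × ℝ) × EuclideanSpace ℝ (Fin d) => b q.1 q.2) {K : ℝ}
    (hK : ∀ p x j, |b p x j| ≤ K) {w u : ℝ × ℝ → EuclideanSpace ℝ (Fin d)}
    (hw : ContinuousOn w (Icc (0 : ℝ × ℝ) 1)) (hu : ContinuousOn u (Icc (0 : ℝ × ℝ) 1))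
    (heq : ∀ p ∈ Icc (0 : ℝ × ℝ) 1, u p - u (p.1, 0) - u (0, p.2) + u (0, 0) =
      ∫ t in (0 : ℝ)..p.2, ∫ s in (0 : ℝ)..p.1, (b (s, t) (w (s, t) + u (s, t)) -
        b (s, t) (w (s, t)))) (i : Fin d) {G : ℝ × ℝ → ℝ} (hG : Measurable G)
    (hGK : ∀ p, G p ∈ Icc 0 (2 * K)) {s₀ t₀ h : ℝ} (hs₀ : 0 ≤ s₀) (hs₁ : s₀ + h ≤ 1) (ht₀ : 0 ≤ t₀)
    (ht₁ : t₀ + h ≤ 1)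
    (hfG : ∀ p ∈ Ioc s₀ (s₀ + h) ×ˢ Ioc t₀ (t₀ + h), |b p (w p + u p) i - b p (w p) i| ≤ G p)
    {p : ℝ × ℝ} (hp : p ∈ Ioc s₀ (s₀ + h) ×ˢ Ioc t₀ (t₀ + h)) :
    |u p i - u (p.1, t₀) i - u (s₀, p.2) i + u (s₀, t₀) i| ≤
      ∫ s in Ioc s₀ (s₀ + h), ∫ t in Ioc t₀ (t₀ + h), G (s, t) := by
  let F : ℝ × ℝ → EuclideanSpace ℝ (Fin d) := fun q =>
    b (clampSquare q) (w (clampSquare q) + u (clampSquare q)) - b (clampSquare q) (w (clampSquare q))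
  have hclamp : ∀ {x : ℝ × ℝ → EuclideanSpace ℝ (Fin d)}, ContinuousOn x (Icc (0 : ℝ × ℝ) 1) →
      Measurable fun q => x (clampSquare q) := fun hx =>
    (hx.comp_continuous continuous_clampSquare clampSquare_mem).measurable
  have hFm : Measurable F :=
    (hmeas.comp (continuous_clampSquare.measurable.prodMk ((hclamp hw).add (hclamp hu)))).sub
      (hmeas.comp (continuous_clampSquare.measurable.prodMk (hclamp hw)))
  have hFj : ∀ j, Measurable fun q => F q j := fun j =>
    (EuclideanSpace.proj (𝕜 := ℝ) j).continuous.measurable.comp hFm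
  have hFK : ∀ j q, |F q j| ≤ 2 * K := fun j q => by
    have h1 := hK (clampSquare q) (w (clampSquare q) + u (clampSquare q)) j
    have h2 := hK (clampSquare q) (w (clampSquare q)) j
    rw [PiLp.sub_apply]
    exact (abs_sub _ _).trans (by linarith)
  have hFeq : ∀ q ∈ Icc (0 : ℝ × ℝ) 1, F q = b q (w q + u q) - b q (w q) := fun q hq => by
    simp only [F, clampSquare_of_mem hq]
  have hv : ∀ q ∈ Icc (0 : ℝ × ℝ) 1, u q i - u (q.1, 0) i - u (0, q.2) i + u (0, 0) i =
      ∫ t in (0 : ℝ)..q.2, ∫ s in (0 : ℝ)..q.1, F (s, t) i := fun q hq => by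
    have hq1 : 0 ≤ q.1 := hq.1.1
    have hq2 : 0 ≤ q.2 := hq.1.2
    have h1 := congrArg (fun x : EuclideanSpace ℝ (Fin d) => x i) (heq q hq)
    simp only [PiLp.add_apply, PiLp.sub_apply] at h1
    have h2 : ∫ t in (0 : ℝ)..q.2, ∫ s in (0 : ℝ)..q.1, (b (s, t) (w (s, t) + u (s, t)) -
        b (s, t) (w (s, t))) = ∫ t in (0 : ℝ)..q.2, ∫ s in (0 : ℝ)..q.1, F (s, t) := by
      refine intervalIntegral.integral_congr fun t ht => intervalIntegral.integral_congr fun s hs => ?_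
      rw [uIcc_of_le hq2] at ht
      rw [uIcc_of_le hq1] at hs
      exact (hFeq (s, t) ⟨⟨hs.1, ht.1⟩, ⟨hs.2.trans hq.2.1, ht.2.trans hq.2.2⟩⟩).symm
    have h3 : ∀ t j, (∫ s in (0 : ℝ)..q.1, F (s, t)) j = ∫ s in (0 : ℝ)..q.1, F (s, t) j :=
      fun t j => intervalIntegral_apply (φ := fun s => F (s, t)) (fun j => intervalIntegrable_of_abs_le
        ((hFj j).comp measurable_prodMk_right) (fun _ => hFK j _) 0 q.1) j
    have h4 : ∀ j, IntervalIntegrable (fun t => (∫ s in (0 : ℝ)..q.1, F (s, t)) j) volume 0 q.2 :=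
      fun j => by
        simp only [h3]
        exact intervalIntegrable_inner (hFj j) (hFK j) _ _ _ _
    rw [h1, h2, intervalIntegral_apply h4]
    simp only [h3]
  have hp1 : p.1 ∈ Icc (0 : ℝ) 1 := ⟨hs₀.trans hp.1.1.le, hp.1.2.trans hs₁⟩
  have hp2 : p.2 ∈ Icc (0 : ℝ) 1 := ⟨ht₀.trans hp.2.1.le, hp.2.2.trans ht₁⟩
  have hincr := rectangle_increment_eq (v := fun q => u q i) (hFj i) (hFK i) hv
    ⟨hs₀, hp.1.1.le.trans hp1.2⟩ hp1 ⟨ht₀, hp.2.1.le.trans hp2.2⟩ hp2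
  rw [show u p i = u (p.1, p.2) i from rfl, hincr]
  refine abs_double_integral_le (f := fun q => F q i) (hFj i) (hFK i) hG hGK hp.1 hp.2 fun q hq => ?_
  beta_reduce
  rw [hFeq q ⟨⟨hs₀.trans hq.1.1.le, ht₀.trans hq.2.1.le⟩, ⟨hq.1.2.trans hs₁, hq.2.2.trans ht₁⟩⟩]
  exact hfG q hq

/-- A number not below `2 ^ (-4 ^ (3 * n / 4))` is comparable to a power `2⁻ʳ` with `r < 4ⁿ`. -/
lemma exists_two_pow_inv_near {n : ℕ} (hn : 0 < n) {S : ℝ}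
    (hS : (2 : ℝ) ^ (-((4 : ℝ) ^ ((3 * (n : ℝ)) / 4))) ≤ S) (hS1 : S ≤ 1) :
    ∃ r < 4 ^ n, S ≤ ((2 : ℝ) ^ r)⁻¹ ∧ ((2 : ℝ) ^ r)⁻¹ ≤ 2 * S := by
  obtain ⟨r, hr, hr'⟩ := exists_nat_pow_near_of_lt_one ((Real.rpow_pos_of_pos two_pos _).trans_le hS)
    hS1 (y := (1 / 2 : ℝ)) (by norm_num) (by norm_num)
  rw [one_div, inv_pow] at hr hr'
  refine ⟨r, ?_, hr', ?_⟩
  · have h1 := hS.trans hr'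
    rw [← Real.rpow_natCast, ← Real.rpow_neg two_pos.le,
      Real.rpow_le_rpow_left_iff one_lt_two, neg_le_neg_iff] at h1
    have h2 : (4 : ℝ) ^ ((3 * (n : ℝ)) / 4) < 4 ^ (n : ℝ) := by
      refine Real.rpow_lt_rpow_of_exponent_lt (by norm_num) ?_
      have : (0 : ℝ) < n := by exact_mod_cast hn
      linarith
    rw [Real.rpow_natCast] at h2
    exact_mod_cast h1.trans_lt h2
  · rw [pow_succ, mul_inv] at hr
    linarith

end Auxiliary

/-- Gronwall-type estimate along the sheet for solutions of the difference
integral equation with small boundary data. -/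
theorem statement4 {Ω : Type*} [MeasurableSpace Ω] (P : Measure Ω) [IsProbabilityMeasure P]
    (d : ℕ) (W : ℝ × ℝ → Ω → EuclideanSpace ℝ (Fin d)) (hW : IsBrownianSheet P d W)
    (b bhat bcheck : ℝ × ℝ → EuclideanSpace ℝ (Fin d) → EuclideanSpace ℝ (Fin d))
    (hmeas : Measurable fun q : (ℝ × ℝ) × EuclideanSpace ℝ (Fin d) => b q.1 q.2)
    (hbdd : ∀ i, ∃ K : ℝ, ∀ p x, |bhat p x i| ≤ K ∧ |bcheck p x i| ≤ K)
    (hdecomp : ∀ p x, b p x = bhat p x - bcheck p x)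
    (hmono : ∀ p (x y : EuclideanSpace ℝ (Fin d)), (∀ j, x j ≤ y j) →
      ∀ i, bhat p x i ≤ bhat p y i ∧ bcheck p x i ≤ bcheck p y i) :
    ∃ (Ω₁ : Set Ω) (C₂ : Ω → ℝ), MeasurableSet Ω₁ ∧ P Ω₁ = 1 ∧
      Measurable C₂ ∧ (∀ ω, 0 < C₂ ω) ∧
      ∀ ω ∈ Ω₁, ∀ n : ℕ, 0 < n →
        C₂ ω * Real.sqrt ((d : ℝ) * n) * (2 : ℝ) ^ (-(n : ℤ)) ≤ 1 / 6 →
        ∀ β : ℝ,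
          β ∈ Set.Icc ((2 : ℝ) ^ (-((4 : ℝ) ^ ((3 * (n : ℝ)) / 4))))
            ((2 : ℝ) ^ (-((4 : ℝ) ^ ((2 * (n : ℝ)) / 3)))) →
        ∀ u : ℝ × ℝ → EuclideanSpace ℝ (Fin d),
          ContinuousOn u (Set.Icc (0 : ℝ × ℝ) 1) →
          (∀ p ∈ Set.Icc (0 : ℝ × ℝ) 1,
            u p - u (p.1, 0) - u (0, p.2) + u (0, 0) =
              ∫ t₁ in (0:ℝ)..p.2, ∫ s₁ in (0:ℝ)..p.1,
                (b (s₁, t₁) (W (s₁, t₁) ω + u (s₁, t₁)) - b (s₁, t₁) (W (s₁, t₁) ω))) →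
          (∀ i : Fin d, ∀ r ∈ Set.Icc (0:ℝ) 1, |u (r, 0) i| ≤ β ∧ |u (0, r) i| ≤ β) →
          ∀ k k' : ℕ, 1 ≤ k → k ≤ 2 ^ n → 1 ≤ k' → k' ≤ 2 ^ n → ∀ i : Fin d,
            sSup ((fun p : ℝ × ℝ => max 0 (u p i)) ''
                (Set.Ioc (((k : ℝ) - 1) * (2 : ℝ) ^ (-(n : ℤ))) ((k : ℝ) * (2 : ℝ) ^ (-(n : ℤ))) ×ˢ
                 Set.Ioc (((k' : ℝ) - 1) * (2 : ℝ) ^ (-(n : ℤ))) ((k' : ℝ) * (2 : ℝ) ^ (-(n : ℤ)))))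
              ≤ 3 ^ (k + k' - 1) *
                  (1 + 3 * C₂ ω * Real.sqrt ((d : ℝ) * n) * (2 : ℝ) ^ (-(n : ℤ))) ^ (k + k') * β ∧
            sSup ((fun p : ℝ × ℝ => max 0 (-(u p i))) ''
                (Set.Ioc (((k : ℝ) - 1) * (2 : ℝ) ^ (-(n : ℤ))) ((k : ℝ) * (2 : ℝ) ^ (-(n : ℤ))) ×ˢ
                 Set.Ioc (((k' : ℝ) - 1) * (2 : ℝ) ^ (-(n : ℤ))) ((k' : ℝ) * (2 : ℝ) ^ (-(n : ℤ)))))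
              ≤ 3 ^ (k + k' - 1) *
                  (1 + 3 * C₂ ω * Real.sqrt ((d : ℝ) * n) * (2 : ℝ) ^ (-(n : ℤ))) ^ (k + k') * β := by
  obtain ⟨K, hK0, hK⟩ : ∃ K : ℝ, 0 < K ∧ ∀ i p x, |bhat p x i| ≤ K ∧ |bcheck p x i| ≤ K := by
    choose K hK using hbdd
    obtain ⟨M, hM⟩ := (finite_range K).bddAbove
    have hKM : ∀ i, K i ≤ max M 1 := fun i => (hM ⟨i, rfl⟩).trans (le_max_left _ _)
    exact ⟨max M 1, by positivity, fun i p x =>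
      ⟨(hK i p x).1.trans (hKM i), (hK i p x).2.trans (hKM i)⟩⟩
  have hbK : ∀ p x j, |b p x j| ≤ 2 * K := fun p x j => by
    rw [hdecomp, PiLp.sub_apply]
    exact (abs_sub _ _).trans (by linarith [hK j p x])
  choose g hg hgK hgb hgH using fun (i : Fin d) (r : ℕ) =>
    exists_oscillation_majorant hmeas hdecomp hmono i (hK i) (x := ((2 : ℝ) ^ r)⁻¹) (by positivity)
  obtain ⟨C, hCm, hC0, hC⟩ := hW.exists_sheetFunctional_bound hg (K := 2 * K) (by positivity)
    (fun i r z => ⟨(hgK i r z).1, (hgK i r z).2.trans (by linarith)⟩)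
    (H := fun i p y => bhat p y i + bcheck p y i)
    (fun i p y => (abs_add_le _ _).trans (by linarith [hK i p y]))
    (fun i p y z hyz => add_le_add (hmono p y z hyz i).1 (hmono p y z hyz i).2) hgH
  obtain ⟨N, hN, hNm, hN0⟩ := exists_measurable_superset_of_null (ae_iff.1 hC)
  refine ⟨Nᶜ, fun ω => 4 * C ω + 4 * K, hNm.compl, (prob_compl_eq_one_iff hNm).2 hN0,
    by fun_prop, fun ω => by linarith [hC0 ω], fun ω hω n hn hθ' β hβ u hu heq hbdry => ?_⟩
  have hC' : ∀ n : ℕ, 0 < n → ∀ k k' r : ℕ, k < 2 ^ n → k' < 2 ^ n → r < 4 ^ n → ∀ i,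
      sheetFunctional W (g i r) (k * ((2 : ℝ) ^ n)⁻¹) (k' * ((2 : ℝ) ^ n)⁻¹) ((2 : ℝ) ^ n)⁻¹ ω ≤
        C ω * √n * (2 * ((2 : ℝ) ^ r)⁻¹ * ((2 : ℝ) ^ n)⁻¹) := by
    by_contra hcon
    exact hω (hN hcon)
  rw [zpow_neg, zpow_natCast] at hθ' ⊢
  set h := ((2 : ℝ) ^ n)⁻¹ with hh
  have hh0 : 0 < h := by positivity
  have hh1 : h ≤ 1 := inv_le_one_of_one_le₀ (one_le_pow₀ one_le_two)
  set θ := (4 * C ω + 4 * K) * √((d : ℝ) * n) * h with hθdef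
  have hCω := hC0 ω
  have hθ0 : 0 ≤ θ := by positivity
  have hβ0 : 0 < β := (Real.rpow_pos_of_pos two_pos _).trans_le hβ.1
  have hle : ∀ {k : ℕ}, k < 2 ^ n → k * h + h ≤ 1 := fun {k} hk => by
    have h1 : (k : ℝ) + 1 ≤ 2 ^ n := by exact_mod_cast hk
    rw [← add_one_mul, hh, ← div_eq_mul_inv]
    exact div_le_one_of_le₀ h1 (by positivity)
  let Q : ℕ → ℕ → Set (ℝ × ℝ) := fun k l => Ioc (k * h) (k * h + h) ×ˢ Ioc (l * h) (l * h + h)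
  have hstep : ∀ k l : ℕ, k < 2 ^ n → l < 2 ^ n → ∀ S, β ≤ S → (∀ i, ∀ p ∈ Q k l, |u p i| ≤ S) →
      ∀ i, ∀ p ∈ Q k l,
        |u p i - u (p.1, l * h) i - u (k * h, p.2) i + u (k * h, l * h) i| ≤ θ * S := by
    intro k l hk hl S hβS hS i p hp
    have hd : (1 : ℝ) ≤ d := by exact_mod_cast i.pos
    have hn1 : (1 : ℝ) ≤ n := by exact_mod_cast hn
    have hsqrt : √(n : ℝ) ≤ √((d : ℝ) * n) := Real.sqrt_le_sqrt (by nlinarith)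
    have hsqrt1 : 1 ≤ √((d : ℝ) * n) := Real.one_le_sqrt.2 (by nlinarith)
    have hS0 : 0 < S := hβ0.trans_le hβS
    have hbound := fun {G : ℝ × ℝ → ℝ} hG hGK hfG => abs_rectangle_increment_le hmeas hbK (hW.2.1 ω)
      hu heq i (G := G) hG hGK (by positivity) (hle hk) (by positivity) (hle hl) hfG hp
    rcases le_total S 1 with hS1 | hS1
    · obtain ⟨r, hr, hSr, hrS⟩ := exists_two_pow_inv_near hn (hβ.1.trans hβS) hS1
      have hG : Measurable fun q : ℝ × ℝ =>
          g i r (q, sheetPath W (projIcc 0 1 zero_le_one q.1) q.2 ω) :=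
        (hg i r).comp (measurable_id.prodMk
          (hW.measurable_sheetPath.comp (measurable_id.prodMk measurable_const)))
      refine (hbound hG (fun q => ⟨(hgK i r _).1, (hgK i r _).2.trans (by linarith)⟩)
        fun q hq => ?_).trans ((hC' n hn k l r hk hl hr i).trans ?_)
      · have hq' : q ∈ Icc (0 : ℝ × ℝ) 1 :=
          ⟨⟨(by positivity : 0 ≤ k * h).trans hq.1.1.le, (by positivity : 0 ≤ l * h).trans hq.2.1.le⟩,
            ⟨hq.1.2.trans (hle hk), hq.2.2.trans (hle hl)⟩⟩
        rw [sheetPath_projIcc, clampSquare_of_mem hq']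
        exact hgb i r q _ _ fun j => (hS j q hq).trans hSr
      · calc C ω * √n * (2 * ((2 : ℝ) ^ r)⁻¹ * h) ≤
              C ω * √((d : ℝ) * n) * (2 * (2 * S) * h) := by gcongr
          _ = 4 * C ω * √((d : ℝ) * n) * h * S := by ring
          _ ≤ θ * S := by
            rw [hθdef]
            gcongr
            linarith
    · refine (hbound measurable_const (G := fun _ => 4 * K)
        (fun q => ⟨by positivity, by linarith⟩) fun q hq => ?_).trans ?_
      · exact (abs_sub _ _).trans (by linarith [hbK q (W q ω + u q) i, hbK q (W q ω) i])
      · simp only [setIntegral_const, Real.volume_real_Ioc, add_sub_cancel_left, max_eq_left hh0.le,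
          smul_eq_mul]
        calc h * (h * (4 * K)) ≤ 1 * (h * (4 * K)) := by gcongr
          _ = 4 * K * 1 * h * 1 := by ring
          _ ≤ θ * S := by
            rw [hθdef]
            gcongr
            linarith
  intro k k' hk hk2 hk' hk2' i
  obtain ⟨k, rfl⟩ := Nat.exists_eq_add_of_le' hk
  obtain ⟨l, rfl⟩ := Nat.exists_eq_add_of_le' hk'
  have hv : ∀ p ∈ Q k l, |u p i| ≤ 3 ^ (k + l + 1) * (1 + 3 * θ) ^ (k + l + 2) * β := fun p hp =>
    abs_le_of_dyadic_increment_le (v := fun i p => u p i)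
      (fun i => (EuclideanSpace.proj (𝕜 := ℝ) i).continuous.comp_continuousOn hu) hβ0.le hθ0 hθ'
      hbdry (fun _ _ => rfl) hstep hk2 hk2' i hp
  have hne : (Q k l).Nonempty :=
    (nonempty_Ioc.2 (by linarith)).prod (nonempty_Ioc.2 (by linarith))
  rw [show (((k + 1 : ℕ) : ℝ) - 1) * h = k * h by push_cast; ring,
    show (((l + 1 : ℕ) : ℝ) - 1) * h = l * h by push_cast; ring,
    show ((k + 1 : ℕ) : ℝ) * h = k * h + h by push_cast; ring,
    show ((l + 1 : ℕ) : ℝ) * h = l * h + h by push_cast; ring,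
    show k + 1 + (l + 1) - 1 = k + l + 1 by omega, show k + 1 + (l + 1) = k + l + 2 by omega,
    show 1 + 3 * (4 * C ω + 4 * K) * √((d : ℝ) * n) * h = 1 + 3 * θ by rw [hθdef]; ring]
  constructor <;> refine csSup_le (hne.image _) ?_ <;> rintro _ ⟨p, hp, rfl⟩
  · exact max_le (by positivity) ((le_abs_self _).trans (hv p hp))
  · exact max_le (by positivity) ((neg_le_abs _).trans (hv p hp))
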